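/- arXiv:2512.24996 — 7 statements merged into one kernel-verified Lean document; each statement's English description precedes it below -/
import Mathlib

section
/- Let X be a Polish metric space and Y a complete separable metric space. Let C ⊆ X^ℕ × Y^ℕ be the set of pairs of sequences ((xₙ)ₙ, (yₙ)ₙ) such that {xₙ : n ∈ ℕ} is dense in X and the assignment xₙ ↦ yₙ is uniformly continuous, meaning: for every ε > 0 there exists δ > 0 such that for all n, m ∈ ℕ, dist(xₙ, xₘ) < δ implies dist(yₙ, yₘ) < ε. Then: (1) C is a Borel subset of X^ℕ × Y^ℕ (product topologies); and (2) there is a Borel measurable map φ : C → C(X,Y) such that for every ((xₙ), (yₙ)) ∈ C and every n, φ((xₙ),(yₙ))(xₙ) = yₙ; that is, φ sends each pair in C to the unique continuous function X → Y extending xₙ ↦ yₙ. -/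
open MeasureTheory

/-- The set `C` of pairs of sequences `((xₙ), (yₙ))` such that `{xₙ}` is dense in `X` and
`xₙ ↦ yₙ` is uniformly continuous. -/
def goodPairs (X Y : Type*) [MetricSpace X] [MetricSpace Y] :
    Set ((ℕ → X) × (ℕ → Y)) :=
  {p | DenseRange p.1 ∧
    ∀ ε : ℝ, 0 < ε → ∃ δ : ℝ, 0 < δ ∧
      ∀ n m : ℕ, dist (p.1 n) (p.1 m) < δ → dist (p.2 n) (p.2 m) < ε}

open TopologicalSpace

/-- A map which is uniformly continuous along a map with dense range extends continuously. -/
theorem DenseRange.exists_continuousMap_extension {ι X Y : Type*} [MetricSpace X] [MetricSpace Y]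
    [CompleteSpace Y] {x : ι → X} {y : ι → Y} (hx : DenseRange x)
    (h : ∀ ε : ℝ, 0 < ε → ∃ δ : ℝ, 0 < δ ∧ ∀ n m, dist (x n) (x m) < δ → dist (y n) (y m) < ε) :
    ∃ g : C(X, Y), ∀ n, g (x n) = y n := by
  let _ : PseudoMetricSpace ι := PseudoMetricSpace.induced x inferInstance
  have hu : IsUniformInducing x := ⟨rfl⟩
  have hy : UniformContinuous y := Metric.uniformContinuous_iff.2 fun ε hε => by
    obtain ⟨δ, hδ, H⟩ := h ε hε
    exact ⟨δ, hδ, fun _ _ hab => H _ _ hab⟩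
  exact ⟨⟨_, (uniformContinuous_uniformly_extend hu hx hy).continuous⟩,
    fun n => uniformly_extend_of_ind hu hx hy n⟩

/-- The Borel σ-algebra of the compact-open topology on `C(X, Y)` is contained in the σ-algebra
generated by the sets `{f | MapsTo f a (closure b)}`, with `a` and `b` ranging over countable bases
of `X` and `Y`. -/
theorem ContinuousMap.borel_le_generateFrom_mapsTo_closure (X Y : Type*) [TopologicalSpace X]
    [SecondCountableTopology X] [TopologicalSpace Y] [RegularSpace Y]
    [SecondCountableTopology Y] :
    borel C(X, Y) ≤ MeasurableSpace.generateFrom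
      (Set.image2 (fun a b => {f : C(X, Y) | Set.MapsTo f a (closure b)})
        (countableBasis X) (countableBasis Y)) := by
  set N := Set.image2 (fun a b => {f : C(X, Y) | Set.MapsTo f a (closure b)})
    (countableBasis X) (countableBasis Y)
  have hNc : N.Countable := (countable_countableBasis X).image2 (countable_countableBasis Y) _
  let T : TopologicalSpace C(X, Y) := generateFrom N
  have hT : T ≤ ContinuousMap.compactOpen := by
    refine le_generateFrom ?_
    rintro _ ⟨K, hK, U, hU, rfl⟩
    refine (@isOpen_iff_forall_mem_open _ T _).2 fun f hf => ?_
    have key : ∀ z ∈ K, ∃ a ∈ countableBasis X, ∃ b ∈ countableBasis Y,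
        z ∈ a ∧ Set.MapsTo f a b ∧ closure b ⊆ U := by
      intro z hz
      obtain ⟨b, hb, hzb, hbU⟩ :=
        (isBasis_countableBasis Y).exists_closure_subset (hU.mem_nhds (hf hz))
      obtain ⟨a, ha, hza, hab⟩ := (isBasis_countableBasis X).exists_subset_of_mem_open
        (show z ∈ f ⁻¹' b from hzb)
        (((isBasis_countableBasis Y).isOpen hb).preimage f.continuous)
      exact ⟨a, ha, b, hb, hza, hab, hbU⟩
    choose! a ha b hb hza hab hbU using key
    obtain ⟨t, htK, ht⟩ := hK.elim_nhds_subcover a fun z hz =>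
      ((isBasis_countableBasis X).isOpen (ha z hz)).mem_nhds (hza z hz)
    refine ⟨⋂ z ∈ t, {g : C(X, Y) | Set.MapsTo g (a z) (closure (b z))}, ?_, ?_, ?_⟩
    · intro g hg z hz
      obtain ⟨w, hw, hzw⟩ := Set.mem_iUnion₂.1 (ht hz)
      exact hbU w (htK w hw) (Set.mem_iInter₂.1 hg w hw hzw)
    · refine @isOpen_biInter_finset _ _ T _ _ fun z hz => ?_
      exact isOpen_generateFrom_of_mem
        (Set.mem_image2_of_mem (ha z (htK z hz)) (hb z (htK z hz)))
    · exact Set.mem_iInter₂.2 fun z hz w hw => subset_closure (hab z (htK z hz) hw)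
  have hsc : @SecondCountableTopology _ T := @SecondCountableTopology.mk _ T ⟨N, hNc, rfl⟩
  rw [← @borel_eq_generateFrom_of_subbasis _ N T hsc rfl]
  exact borel_anti hT

theorem measurableSet_goodPairs (X Y : Type*) [MetricSpace X] [SecondCountableTopology X]
    [MeasurableSpace X] [BorelSpace X] [MetricSpace Y] [SecondCountableTopology Y]
    [MeasurableSpace Y] [BorelSpace Y] : MeasurableSet (goodPairs X Y) := by
  have hx (n : ℕ) : Measurable fun p : (ℕ → X) × (ℕ → Y) => p.1 n :=
    (measurable_pi_apply n).comp measurable_fst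
  have hy (n : ℕ) : Measurable fun p : (ℕ → X) × (ℕ → Y) => p.2 n :=
    (measurable_pi_apply n).comp measurable_snd
  have heq : goodPairs X Y =
      (⋂ a ∈ countableBasis X, ⋃ n : ℕ, {p | p.1 n ∈ a}) ∩
      ⋂ k : ℕ, ⋃ l : ℕ, ⋂ n : ℕ, ⋂ m : ℕ,
        {p | dist (p.1 n) (p.1 m) < 1 / ((l : ℝ) + 1) →
          dist (p.2 n) (p.2 m) < 1 / ((k : ℝ) + 1)} := by
    ext p
    simp only [goodPairs, Set.mem_ofPred_eq, Set.mem_inter_iff, Set.mem_iInter, Set.mem_iUnion]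
    refine and_congr ⟨fun h a ha => ?_, fun h => ?_⟩ ⟨fun h k => ?_, fun h ε hε => ?_⟩
    · exact h.exists_mem_open (isOpen_of_mem_countableBasis ha)
        (nonempty_of_mem_countableBasis ha)
    · refine (isBasis_countableBasis X).dense_iff.2 fun a ha _ => ?_
      obtain ⟨n, hn⟩ := h a ha
      exact ⟨_, hn, n, rfl⟩
    · obtain ⟨δ, hδ, H⟩ := h _ (Nat.one_div_pos_of_nat (n := k))
      obtain ⟨l, hl⟩ := exists_nat_one_div_lt hδ
      exact ⟨l, fun n m hnm => H n m (hnm.trans hl)⟩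
    · obtain ⟨k, hk⟩ := exists_nat_one_div_lt hε
      obtain ⟨l, hl⟩ := h k
      exact ⟨_, Nat.one_div_pos_of_nat (n := l), fun n m hnm => (hl n m hnm).trans hk⟩
  rw [heq]
  refine .inter (.biInter (countable_countableBasis X) fun a ha => .iUnion fun n => ?_)
    (.iInter fun k => .iUnion fun l => .iInter fun n => .iInter fun m => ?_)
  · exact hx n (isOpen_of_mem_countableBasis ha).measurableSet
  · exact (measurableSet_lt ((hx n).dist (hx m)) measurable_const).imp
      (measurableSet_lt ((hy n).dist (hy m)) measurable_const)

/-- For `X` a Polish metric space and `Y` a complete separable metric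
space: (1) the set `C = goodPairs X Y` is Borel in `X^ℕ × Y^ℕ`; and (2) there is a Borel
measurable map `φ : C → C(X,Y)` sending each pair `((xₙ), (yₙ)) ∈ C` to the (unique)
continuous function `X → Y` extending `xₙ ↦ yₙ`. -/
theorem goodPairs_borel_and_borel_extension
    {X Y : Type*} [MetricSpace X] [PolishSpace X]
    [MetricSpace Y] [TopologicalSpace.SeparableSpace Y] [CompleteSpace Y] :
    MeasurableSet[borel ((ℕ → X) × (ℕ → Y))] (goodPairs X Y) ∧
      ∃ φ : goodPairs X Y → C(X, Y),
        @Measurable _ _ (borel _) (borel _) φ ∧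
        ∀ (p : goodPairs X Y) (n : ℕ),
          φ p ((p : (ℕ → X) × (ℕ → Y)).1 n) = (p : (ℕ → X) × (ℕ → Y)).2 n := by
  have : SecondCountableTopology Y := UniformSpace.secondCountable_of_separable Y
  borelize X Y
  rw [← BorelSpace.measurable_eq (α := (ℕ → X) × (ℕ → Y)),
    ← BorelSpace.measurable_eq (α := goodPairs X Y)]
  refine ⟨measurableSet_goodPairs X Y, ?_⟩
  choose φ hφ using fun p : goodPairs X Y =>
    DenseRange.exists_continuousMap_extension p.2.1 p.2.2
  refine ⟨φ, Measurable.mono (measurable_generateFrom ?_) le_rfl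
    (ContinuousMap.borel_le_generateFrom_mapsTo_closure X Y), hφ⟩
  rintro _ ⟨a, ha, b, -, rfl⟩
  have hao := isOpen_of_mem_countableBasis ha
  have heq : φ ⁻¹' {f | Set.MapsTo f a (closure b)} =
      ⋂ n : ℕ, {p : goodPairs X Y | p.1.1 n ∈ a → p.1.2 n ∈ closure b} := by
    ext p
    simp only [Set.mem_preimage, Set.mem_ofPred_eq, Set.mem_iInter]
    refine ⟨fun h n hn => hφ p n ▸ h hn, fun h z hz => ?_⟩
    by_contra hzb
    obtain ⟨n, hna, hnb⟩ := DenseRange.exists_mem_open p.2.1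
      (hao.inter (isClosed_closure.isOpen_compl.preimage (φ p).continuous)) ⟨z, hz, hzb⟩
    exact hnb (by simpa only [hφ p n] using h n hna)
  rw [heq]
  refine .iInter fun n => MeasurableSet.imp ?_ ?_
  · exact ((measurable_pi_apply n).comp (measurable_fst.comp measurable_subtype_coe))
      hao.measurableSet
  · exact ((measurable_pi_apply n).comp (measurable_snd.comp measurable_subtype_coe))
      isClosed_closure.measurableSet
end

section
/- Let X be a compact metric space and Y a locally compact Polish metric space. Define I : C([0,1],Y) × C(X,Y) → ℝ ∪ {u} (where u is an added isolated point, i.e. the target is Option ℝ) by: I(f,g) = min{t ∈ [0,1] : f(t) ∈ range(g)} if range(f) ∩ range(g) ≠ ∅ (this minimum exists, since {t : f(t) ∈ range(g)} is a nonempty compact subset of [0,1]), and I(f,g) = u otherwise. Then I is Borel measurable. -/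
/-- The topology on `Option α = α ∪ {u}` making `u = none` an isolated point and `α`
openly embedded (the disjoint union of `α` and a single point). -/
instance Option.instTopologicalSpace {α : Type*} [TopologicalSpace α] :
    TopologicalSpace (Option α) :=
  TopologicalSpace.coinduced some inferInstance

open Set in
/-- For a closed set `S` of times, the set of pairs `(f, g)` such that `f` meets the range of `g`
at a time in `S` is closed. -/
theorem ContinuousMap.isClosed_setOf_exists_mem_range {T X Y : Type*}
    [TopologicalSpace T] [CompactSpace T] [LocallyCompactSpace T]
    [TopologicalSpace X] [CompactSpace X] [LocallyCompactSpace X]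
    [TopologicalSpace Y] [T2Space Y] {S : Set T} (hS : IsClosed S) :
    IsClosed {p : C(T, Y) × C(X, Y) | ∃ t ∈ S, p.1 t ∈ range p.2} := by
  have hC : IsClosed {q : (C(T, Y) × C(X, Y)) × (T × X) |
      q.2.1 ∈ S ∧ q.1.1 q.2.1 = q.1.2 q.2.2} :=
    (hS.preimage (by fun_prop)).inter (isClosed_eq (by fun_prop) (by fun_prop))
  convert isClosedMap_fst_of_compactSpace _ hC using 1
  ext p
  constructor
  · rintro ⟨t, ht, x, hx⟩
    exact ⟨(p, t, x), ⟨ht, hx.symm⟩, rfl⟩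
  · rintro ⟨⟨p, t, x⟩, ⟨ht, hx⟩, rfl⟩
    exact ⟨t, ht, x, hx.symm⟩

/-- If `f` meets the range of `g`, there is a first time at which it does. -/
theorem ContinuousMap.exists_isLeast_mem_range {T X Y : Type*}
    [TopologicalSpace T] [CompactSpace T] [LinearOrder T] [ClosedIicTopology T]
    [TopologicalSpace X] [CompactSpace X]
    [TopologicalSpace Y] [T2Space Y] (f : C(T, Y)) (g : C(X, Y))
    (h : ∃ t, f t ∈ Set.range g) :
    ∃ t, IsLeast {t | f t ∈ Set.range g} t :=
  ((isCompact_range g.continuous).isClosed.preimage f.continuous).isCompact.exists_isLeast h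

/-- For `X` a compact metric space and `Y` a locally compact Polish
metric space, the map `I : C([0,1],Y) × C(X,Y) → ℝ ∪ {u}` sending `(f, g)` to the minimum
of `{t ∈ [0,1] : f(t) ∈ range g}` when `range f ∩ range g ≠ ∅`, and to the added isolated
point `u = none` otherwise, is Borel measurable. -/
theorem measurable_first_intersection
    {X Y : Type*} [MetricSpace X] [CompactSpace X]
    [MetricSpace Y] [PolishSpace Y] [LocallyCompactSpace Y] :
    ∃ I : C(unitInterval, Y) × C(X, Y) → Option ℝ,
      @Measurable _ _ (borel _) (borel _) I ∧
      ∀ (f : C(unitInterval, Y)) (g : C(X, Y)),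
        (¬(Set.range ⇑f ∩ Set.range ⇑g).Nonempty → I (f, g) = none) ∧
        ((Set.range ⇑f ∩ Set.range ⇑g).Nonempty →
          ∃ t : unitInterval, f t ∈ Set.range ⇑g ∧
            (∀ s : unitInterval, f s ∈ Set.range ⇑g → (t : ℝ) ≤ (s : ℝ)) ∧
            I (f, g) = some (t : ℝ)) := by
  classical
  let A : Set (C(unitInterval, Y) × C(X, Y)) := {p | ∃ t, p.1 t ∈ Set.range p.2}
  have hmin (p : C(unitInterval, Y) × C(X, Y)) :
      ∃ t : unitInterval, p ∈ A → IsLeast {t | p.1 t ∈ Set.range p.2} t := by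
    by_cases hp : p ∈ A
    · obtain ⟨t, ht⟩ := p.1.exists_isLeast_mem_range p.2 hp
      exact ⟨t, fun _ => ht⟩
    · exact ⟨0, fun h => absurd h hp⟩
  choose τ hτ using hmin
  let : MeasurableSpace (C(unitInterval, Y) × C(X, Y)) := borel _
  have : BorelSpace (C(unitInterval, Y) × C(X, Y)) := ⟨rfl⟩
  let : MeasurableSpace (Option ℝ) := borel _
  have : BorelSpace (Option ℝ) := ⟨rfl⟩
  have hA : MeasurableSet A := by
    simpa [A] using (ContinuousMap.isClosed_setOf_exists_mem_range
      (X := X) (Y := Y) (isClosed_univ (X := unitInterval))).measurableSet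
  have hT : Measurable fun p => if p ∈ A then (τ p : ℝ) else 0 := by
    refine measurable_of_Iic fun a => ?_
    have hS : IsClosed {t : unitInterval | (t : ℝ) ≤ a} :=
      isClosed_le continuous_subtype_val continuous_const
    convert (ContinuousMap.isClosed_setOf_exists_mem_range
      (X := X) (Y := Y) hS).measurableSet.union
        (hA.compl.inter (MeasurableSet.const (0 ≤ a))) using 1
    ext p
    by_cases hp : p ∈ A
    · simp only [Set.mem_preimage, Set.mem_Iic, Set.mem_union, Set.mem_inter_iff,
        Set.mem_compl_iff, hp, not_true_eq_false, false_and, or_false]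
      exact ⟨fun h => ⟨τ p, h, (hτ p hp).1⟩,
        fun ⟨t, hta, ht⟩ => le_trans (Subtype.coe_le_coe.2 ((hτ p hp).2 ht)) hta⟩
    · simp only [Set.mem_preimage, Set.mem_Iic, Set.mem_union, Set.mem_inter_iff,
        Set.mem_compl_iff, hp, not_false_eq_true, true_and, Set.mem_ofPred_eq]
      exact ⟨Or.inr, fun h => h.resolve_left fun ⟨t, _, ht⟩ => hp ⟨t, ht⟩⟩
  have hsome : Continuous (some : ℝ → Option ℝ) := continuous_coinduced_rng
  have hmem (f : C(unitInterval, Y)) (g : C(X, Y)) :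
      (Set.range f ∩ Set.range g).Nonempty ↔ (f, g) ∈ A :=
    ⟨fun ⟨_, ⟨t, ht⟩, hy⟩ => ⟨t, ht ▸ hy⟩, fun ⟨t, ht⟩ => ⟨f t, ⟨t, rfl⟩, ht⟩⟩
  refine ⟨fun p => if p ∈ A then some (if p ∈ A then (τ p : ℝ) else 0) else none,
    Measurable.ite hA (hsome.measurable.comp hT) measurable_const, fun f g => ?_⟩
  rw [hmem]
  exact ⟨fun h => if_neg h, fun h => ⟨τ (f, g), (hτ _ h).1,
    fun s hs => (hτ _ h).2 hs, by simp only [if_pos h]⟩⟩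
end

section
/- Let X be a locally compact Polish space. Then the relation 'the closure of V is contained in W' is Borel on O(X) × O(X); that is, the set {(V, W) ∈ O(X) × O(X) : closure(V) ⊆ W} is a Borel subset of O(X) × O(X). -/
open TopologicalSpace MeasureTheory

/-- The Fell topology on the space `F(X)` of closed subsets of `X`, generated by the
subbasic open sets `{F : F ∩ K = ∅}` for `K ⊆ X` compact and `{F : F ∩ U ≠ ∅}` for
`U ⊆ X` open. -/
def fellTopology (X : Type*) [TopologicalSpace X] : TopologicalSpace (Closeds X) :=
  TopologicalSpace.generateFrom
    ({S | ∃ K : Set X, IsCompact K ∧ S = {F : Closeds X | (F : Set X) ∩ K = ∅}} ∪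
      {S | ∃ U : Set X, IsOpen U ∧ S = {F : Closeds X | ((F : Set X) ∩ U).Nonempty}})

/-- The topology on the space `O(X)` of open subsets of `X`, transported from the Fell
topology on `F(X)` by complementation `U ↦ X \ U`. -/
def opensFellTopology (X : Type*) [TopologicalSpace X] : TopologicalSpace (Opens X) :=
  TopologicalSpace.induced (fun U : Opens X => U.compl) (fellTopology X)

/-- The Borel σ-algebra on `O(X)` transported from the Fell topology by complementation. -/
def opensFellBorel (X : Type*) [TopologicalSpace X] : MeasurableSpace (Opens X) :=
  @borel _ (opensFellTopology X)

theorem measurableSet_setOf_isCompact_subset {X : Type*} [TopologicalSpace X] {K : Set X}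
    (hK : IsCompact K) : MeasurableSet[opensFellBorel X] {W : Opens X | K ⊆ W} := by
  refine MeasurableSpace.measurableSet_generateFrom
    ⟨_, TopologicalSpace.isOpen_generateFrom_of_mem (Or.inl ⟨K, hK, rfl⟩), ?_⟩
  ext W
  simp only [Set.mem_preimage, Set.mem_ofPred_eq, Opens.coe_compl, ← Set.disjoint_iff_inter_eq_empty,
    Set.disjoint_compl_left_iff_subset]

theorem measurableSet_setOf_compl_inter_nonempty {X : Type*} [TopologicalSpace X] {U : Set X}
    (hU : IsOpen U) : MeasurableSet[opensFellBorel X] {V : Opens X | ((V : Set X)ᶜ ∩ U).Nonempty} :=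
  MeasurableSpace.measurableSet_generateFrom
    ⟨_, TopologicalSpace.isOpen_generateFrom_of_mem (Or.inr ⟨U, hU, rfl⟩), rfl⟩

theorem measurableSet_setOf_disjoint {X : Type*} [TopologicalSpace X] [SecondCountableTopology X]
    {O : Set X} (hO : IsOpen O) :
    MeasurableSet[opensFellBorel X] {V : Opens X | Disjoint (V : Set X) O} := by
  have h : {V : Opens X | Disjoint (V : Set X) O} =
      ⋂ B ∈ {B ∈ countableBasis X | B ⊆ O}, {V : Opens X | ((V : Set X)ᶜ ∩ B).Nonempty} := by
    ext V
    simp only [Set.mem_ofPred_eq, Set.mem_iInter]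
    constructor
    · rintro h B ⟨hB, hBO⟩
      obtain ⟨x, hx⟩ := nonempty_of_mem_countableBasis hB
      exact ⟨x, fun hxV => Set.disjoint_left.1 h hxV (hBO hx), hx⟩
    · intro h
      rw [Set.disjoint_left]
      intro x hxV hxO
      obtain ⟨B, hB, -, hBs⟩ := (isBasis_countableBasis X).exists_subset_of_mem_open
        (⟨hxV, hxO⟩ : x ∈ (V : Set X) ∩ O) (V.isOpen.inter hO)
      obtain ⟨y, hyV, hyB⟩ := h B ⟨hB, fun z hz => (hBs hz).2⟩
      exact hyV (hBs hyB).1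
  rw [h]
  exact MeasurableSet.biInter ((countable_countableBasis X).mono (Set.sep_subset _ _))
    fun B hB => measurableSet_setOf_compl_inter_nonempty (isOpen_of_mem_countableBasis hB.1)

/-- In a locally compact Hausdorff space, a point of an open set has a basic neighbourhood whose
closure is compact and contained in that open set. -/
theorem exists_mem_countableBasis_isCompact_closure {X : Type*} [TopologicalSpace X]
    [SecondCountableTopology X] [T2Space X] [LocallyCompactSpace X] {W : Set X} (hW : IsOpen W)
    {x : X} (hx : x ∈ W) :
    ∃ B ∈ countableBasis X, x ∈ B ∧ IsCompact (closure B) ∧ closure B ⊆ W := by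
  obtain ⟨K, hK, hxK, hKW⟩ := exists_compact_subset hW hx
  obtain ⟨B, hB, hxB, hBK⟩ :=
    (isBasis_countableBasis X).exists_subset_of_mem_open hxK isOpen_interior
  have hcl : closure B ⊆ K := closure_minimal (hBK.trans interior_subset) hK.isClosed
  exact ⟨B, hB, hxB, hK.of_isClosed_subset isClosed_closure hcl, hcl.trans hKW⟩

/-- In a locally compact Hausdorff space, a finite union of closures of basic open sets can be
interpolated between a compact set and an open set containing it. -/
theorem exists_finite_subset_countableBasis_interpolation {X : Type*} [TopologicalSpace X]
    [SecondCountableTopology X] [T2Space X] [LocallyCompactSpace X] {C W : Set X}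
    (hC : IsCompact C) (hW : IsOpen W) (hCW : C ⊆ W) :
    ∃ s ⊆ countableBasis X, s.Finite ∧ IsCompact (⋃ B ∈ s, closure B) ∧
      C ⊆ ⋃ B ∈ s, closure B ∧ (⋃ B ∈ s, closure B) ⊆ W := by
  obtain ⟨s, hs, hsf, hCs⟩ := hC.elim_finite_subcover_image
    (b := {B ∈ countableBasis X | IsCompact (closure B) ∧ closure B ⊆ W}) (c := id)
    (fun B hB => isOpen_of_mem_countableBasis hB.1) (by
      intro x hx
      obtain ⟨B, hB, hxB, h⟩ := exists_mem_countableBasis_isCompact_closure hW (hCW hx)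
      exact Set.mem_biUnion (⟨hB, h⟩ : B ∈ {B ∈ countableBasis X | _}) hxB)
  exact ⟨s, fun B hB => (hs hB).1, hsf, hsf.isCompact_biUnion fun B hB => (hs hB).2.1,
    hCs.trans (Set.iUnion₂_mono fun B _ => subset_closure), Set.iUnion₂_subset fun B hB => (hs hB).2.2⟩

theorem closure_subset_iff_forall_countableBasis {X : Type*} [TopologicalSpace X]
    [SecondCountableTopology X] [T2Space X] [LocallyCompactSpace X] {V W : Set X}
    (hW : IsOpen W) :
    closure V ⊆ W ↔ ∀ U ∈ {U ∈ countableBasis X | IsCompact (closure U)},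
      ∃ s ∈ {s : Set (Set X) | (s.Finite ∧ s ⊆ countableBasis X) ∧
        IsCompact (⋃ B ∈ s, closure B)},
        Disjoint V (U \ ⋃ B ∈ s, closure B) ∧ (⋃ B ∈ s, closure B) ⊆ W := by
  constructor
  · rintro h U ⟨-, hU⟩
    obtain ⟨s, hs, hsf, hsc, hCs, hsW⟩ := exists_finite_subset_countableBasis_interpolation
      (hU.inter_right isClosed_closure) hW (Set.inter_subset_right.trans h)
    exact ⟨s, ⟨⟨hsf, hs⟩, hsc⟩, Set.disjoint_left.2 fun x hxV hxU =>
      hxU.2 (hCs ⟨subset_closure hxU.1, subset_closure hxV⟩), hsW⟩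
  · intro h x hx
    obtain ⟨U, hU, hxU, hUc, -⟩ :=
      exists_mem_countableBasis_isCompact_closure isOpen_univ (Set.mem_univ x)
    obtain ⟨s, ⟨-, hsc⟩, hd, hsW⟩ := h U ⟨hU, hUc⟩
    refine hsW (closure_minimal (s := U ∩ V) ?_ hsc.isClosed
      ((isOpen_of_mem_countableBasis hU).inter_closure ⟨hxU, hx⟩))
    rintro y ⟨hyU, hyV⟩
    by_contra hy
    exact Set.disjoint_left.1 hd hyV ⟨hyU, hy⟩

/-- For `X` a locally compact Polish space, the relation
"`closure V ⊆ W`" is Borel on `O(X) × O(X)`. -/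
theorem measurableSet_closure_subset
    {X : Type*} [TopologicalSpace X] [PolishSpace X] [LocallyCompactSpace X] :
    MeasurableSet[(opensFellBorel X).prod (opensFellBorel X)]
      {p : Opens X × Opens X | closure (p.1 : Set X) ⊆ (p.2 : Set X)} := by
  let _ : MeasurableSpace (Opens X) := opensFellBorel X
  have h : {p : Opens X × Opens X | closure (p.1 : Set X) ⊆ (p.2 : Set X)} =
      ⋂ U ∈ {U ∈ countableBasis X | IsCompact (closure U)},
        ⋃ s ∈ {s : Set (Set X) | (s.Finite ∧ s ⊆ countableBasis X) ∧
          IsCompact (⋃ B ∈ s, closure B)},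
          {V : Opens X | Disjoint (V : Set X) (U \ ⋃ B ∈ s, closure B)} ×ˢ
            {W : Opens X | (⋃ B ∈ s, closure B) ⊆ (W : Set X)} := by
    ext p
    rw [Set.mem_ofPred_eq, closure_subset_iff_forall_countableBasis p.2.isOpen]
    simp only [Set.mem_iInter, Set.mem_iUnion, exists_prop, Set.mem_prod, Set.mem_ofPred_eq]
  rw [h]
  have hb := countable_countableBasis X
  refine MeasurableSet.biInter (hb.mono (Set.sep_subset _ _)) fun U hU =>
    MeasurableSet.biUnion ((Set.countable_ofPred_finite_subset hb).mono fun s hs => hs.1)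
      fun s hs => ?_
  exact (measurableSet_setOf_disjoint
    ((isOpen_of_mem_countableBasis hU.1).sdiff hs.2.isClosed)).prod
      (measurableSet_setOf_isCompact_subset hs.2)
end

section
/- Let X be a locally compact Polish space with a fixed compatible complete metric, let (qᵢ)ᵢ∈ℕ be a fixed injective enumeration of a countable dense subset of X, and let u be an added isolated point (so X ∪ {u} is the topological disjoint union of X and a point, formally Option X). Let 𝒯 be the set of triples (U, V, (rᵢ)ᵢ∈ℕ) ∈ O(X) × O(X) × (X ∪ {u})^ℕ such that: (i) if qᵢ ∈ U then rᵢ ∈ V, and if qᵢ ∉ U then rᵢ = u; and (ii) there exists a homeomorphism φ from U onto V (with their subspace topologies) such that φ(qᵢ) = rᵢ for every i with qᵢ ∈ U. Then 𝒯 is a Borel subset of O(X) × O(X) × (X ∪ {u})^ℕ (product of the Borel structures, with (X ∪ {u})^ℕ carrying the product topology and its Borel σ-algebra). -/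
open TopologicalSpace MeasureTheory

open Topology

/-- In a second countable locally compact Hausdorff space there are countably many compact sets
that separate compact sets from the complements of their open neighbourhoods. -/
theorem exists_countable_compact_between (X : Type*) [TopologicalSpace X] [T2Space X]
    [SecondCountableTopology X] [LocallyCompactSpace X] :
    ∃ 𝒦 : Set (Set X), 𝒦.Countable ∧ (∀ K ∈ 𝒦, IsCompact K) ∧
      ∀ C U : Set X, IsCompact C → IsOpen U → C ⊆ U → ∃ K ∈ 𝒦, C ⊆ interior K ∧ K ⊆ U := by
  let 𝒟 : Set (Set X) := (fun s : Set (Set X) => closure (⋃₀ s)) ''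
    {s | s.Finite ∧ s ⊆ countableBasis X}
  have h𝒟 : 𝒟.Countable :=
    (Set.countable_ofPred_finite_subset (countable_countableBasis X)).image _
  refine ⟨{K ∈ 𝒟 | IsCompact K}, h𝒟.mono (Set.sep_subset _ _), fun K hK => hK.2, ?_⟩
  intro C U hC hU hCU
  obtain ⟨K, hK, hCK, hKU⟩ := exists_compact_between hC hU hCU
  obtain ⟨s, hs, hsb, hCs, hsK⟩ : ∃ s : Set (Set X), s.Finite ∧ s ⊆ countableBasis X ∧
      C ⊆ ⋃₀ s ∧ ⋃₀ s ⊆ K := by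
    refine hC.induction_on (p := fun C => ∃ s : Set (Set X), s.Finite ∧ s ⊆ countableBasis X ∧
      C ⊆ ⋃₀ s ∧ ⋃₀ s ⊆ K) ⟨∅, by simp⟩ ?_ ?_ ?_
    · rintro A B hAB ⟨s, h₁, h₂, h₃, h₄⟩
      exact ⟨s, h₁, h₂, hAB.trans h₃, h₄⟩
    · rintro A B ⟨s, h₁, h₂, h₃, h₄⟩ ⟨t, k₁, k₂, k₃, k₄⟩
      refine ⟨s ∪ t, h₁.union k₁, Set.union_subset h₂ k₂, ?_, ?_⟩
      · rw [Set.sUnion_union]; exact Set.union_subset_union h₃ k₃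
      · rw [Set.sUnion_union]; exact Set.union_subset h₄ k₄
    · intro x hx
      obtain ⟨B, hB, hxB, hBK⟩ := (isBasis_countableBasis X).mem_nhds_iff.1
        (mem_interior_iff_mem_nhds.1 (hCK hx))
      exact ⟨B, mem_nhdsWithin_of_mem_nhds (((isBasis_countableBasis X).isOpen hB).mem_nhds hxB),
        {B}, by simp, by simpa using hB, by simp, by simpa using hBK⟩
  have hsub : closure (⋃₀ s) ⊆ K := closure_minimal hsK hK.isClosed
  refine ⟨closure (⋃₀ s), ⟨⟨s, ⟨hs, hsb⟩, rfl⟩, hK.of_isClosed_subset isClosed_closure hsub⟩,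
    ?_, hsub.trans hKU⟩
  refine hCs.trans (interior_maximal subset_closure ?_)
  exact isOpen_sUnion fun B hB => (isBasis_countableBasis X).isOpen (hsb hB)

theorem Option.isOpenEmbedding_some {α : Type*} [TopologicalSpace α] :
    IsOpenEmbedding (some : α → Option α) := by
  refine .of_continuous_injective_isOpenMap continuous_coinduced_rng (Option.some_injective α) ?_
  intro s hs
  rw [isOpen_coinduced, Set.preimage_image_eq _ (Option.some_injective α)]
  exact hs

theorem Option.isClosed_image_some {α : Type*} [TopologicalSpace α] {s : Set α}
    (hs : IsClosed s) : IsClosed ((some : α → Option α) '' s) := by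
  rw [isClosed_coinduced, Set.preimage_image_eq _ (Option.some_injective α)]
  exact hs

theorem Option.isClosed_singleton_none {α : Type*} [TopologicalSpace α] :
    IsClosed {(none : Option α)} := by
  rw [isClosed_coinduced]
  convert isClosed_empty
  ext
  simp

theorem measurableSet_opensFellBorel_subset {X : Type*} [TopologicalSpace X] {K : Set X}
    (hK : IsCompact K) : MeasurableSet[opensFellBorel X] {U : Opens X | K ⊆ U} := by
  refine MeasurableSpace.measurableSet_generateFrom ?_
  refine ⟨{F : Closeds X | (F : Set X) ∩ K = ∅}, .basic _ (.inl ⟨K, hK, rfl⟩), ?_⟩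
  ext U
  simp [← Set.disjoint_iff_inter_eq_empty, Set.disjoint_compl_left_iff_subset]

/-- The family of pairs `(a i, b i)` is the graph of a map that, on each member of `𝒦` inside `U`,
is uniformly continuous and takes values in a member of `𝒦` inside `V`. -/
def UniformOnFamily {X ι : Type*} [MetricSpace X] (𝒦 : Set (Set X)) {U V : Set X}
    (a : ι → U) (b : ι → V) : Prop :=
  ∀ K ∈ 𝒦, K ⊆ U → (∃ L ∈ 𝒦, L ⊆ V ∧ ∀ i, (a i : X) ∈ K → (b i : X) ∈ L) ∧
    ∀ n : ℕ, ∃ m : ℕ, ∀ i j, (a i : X) ∈ K → (a j : X) ∈ K →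
      dist (a i : X) (a j) < 1 / (m + 1) → dist (b i : X) (b j) < 1 / (n + 1)

section

variable {X ι : Type*} [MetricSpace X] {𝒦 : Set (Set X)} {U V : Set X} {a : ι → U} {b : ι → V}

theorem UniformOnFamily.exists_continuous [CompleteSpace X] (h𝒦 : ∀ K ∈ 𝒦, IsCompact K)
    (hU : ∀ x ∈ U, ∃ K ∈ 𝒦, K ∈ 𝓝 x ∧ K ⊆ U) (ha : DenseRange a)
    (h : UniformOnFamily 𝒦 a b) : ∃ f : U → V, Continuous f ∧ ∀ i, f (a i) = b i := by
  let : TopologicalSpace ι := .induced a inferInstance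
  have hd : IsDenseInducing a := ⟨⟨rfl⟩, ha⟩
  have hlim : ∀ x : U, ∃ c : V, Filter.Tendsto b (Filter.comap a (𝓝 x)) (𝓝 c) := by
    intro x
    obtain ⟨K, hK, hKx, hKU⟩ := hU x x.2
    obtain ⟨⟨L, hL, hLV, hmap⟩, hunif⟩ := h K hK hKU
    have : (Filter.comap a (𝓝 x)).NeBot := hd.comap_nhds_neBot x
    have hmem : ∀ {ε : ℝ}, 0 < ε → {i | (a i : X) ∈ K ∧ dist (a i : X) x < ε} ∈
        Filter.comap a (𝓝 x) := by
      intro ε hε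
      refine ⟨Subtype.val ⁻¹' (K ∩ Metric.ball (x : X) ε), ?_, fun i hi => hi⟩
      exact continuous_subtype_val.continuousAt.preimage_mem_nhds
        (Filter.inter_mem hKx (Metric.ball_mem_nhds _ hε))
    have hc : Cauchy (Filter.map (fun i => (b i : X)) (Filter.comap a (𝓝 x))) := by
      rw [Metric.cauchy_iff]
      refine ⟨inferInstance, fun ε hε => ?_⟩
      obtain ⟨n, hn⟩ := exists_nat_one_div_lt hε
      obtain ⟨m, hm⟩ := hunif n
      have hpos : (0 : ℝ) < 1 / (m + 1) := Nat.one_div_pos_of_nat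
      refine ⟨_, Filter.image_mem_map (hmem (half_pos hpos)), ?_⟩
      rintro _ ⟨i, hi, rfl⟩ _ ⟨j, hj, rfl⟩
      refine (hm i j hi.1 hj.1 ?_).trans hn
      have := dist_triangle_right (a i : X) (a j) x
      linarith [hi.2, hj.2]
    obtain ⟨c, hc⟩ := CompleteSpace.complete hc
    have hcL : c ∈ L := (h𝒦 L hL).isClosed.mem_of_tendsto (f := fun i => (b i : X)) hc
      (Filter.mem_of_superset (hmem one_pos) fun i hi => hmap i hi.1)
    exact ⟨⟨c, hLV hcL⟩, tendsto_subtype_rng.2 hc⟩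
  refine ⟨hd.extend b, hd.continuous_extend hlim, fun i => ?_⟩
  exact hd.extend_eq' hlim i

theorem UniformOnFamily.of_continuous (h𝒦 : ∀ K ∈ 𝒦, IsCompact K)
    (hV : ∀ C ⊆ V, IsCompact C → ∃ L ∈ 𝒦, C ⊆ L ∧ L ⊆ V) {f : U → V} (hf : Continuous f)
    (hfa : ∀ i, f (a i) = b i) : UniformOnFamily 𝒦 a b := by
  intro K hK hKU
  have hK' : IsCompact (Subtype.val ⁻¹' K : Set U) := by
    rw [Subtype.isCompact_iff, Subtype.image_preimage_coe, Set.inter_eq_right.2 hKU]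
    exact h𝒦 K hK
  have hf' : Continuous fun x => (f x : X) := continuous_subtype_val.comp hf
  constructor
  · obtain ⟨L, hL, hCL, hLV⟩ := hV ((fun x => (f x : X)) '' (Subtype.val ⁻¹' K))
      (by rintro _ ⟨x, -, rfl⟩; exact (f x).2) (hK'.image hf')
    exact ⟨L, hL, hLV, fun i hi => hCL ⟨a i, hi, by simp [hfa]⟩⟩
  · intro n
    obtain ⟨δ, hδ, H⟩ := Metric.uniformContinuousOn_iff.1
      (hK'.uniformContinuousOn_of_continuous hf'.continuousOn) (1 / (n + 1))
      Nat.one_div_pos_of_nat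
    obtain ⟨m, hm⟩ := exists_nat_one_div_lt hδ
    refine ⟨m, fun i j hi hj hij => ?_⟩
    simpa only [hfa] using H (a i) hi (a j) hj (hij.trans hm)

theorem exists_homeomorph_iff_uniformOnFamily [CompleteSpace X] (h𝒦 : ∀ K ∈ 𝒦, IsCompact K)
    (hsep : ∀ C U : Set X, IsCompact C → IsOpen U → C ⊆ U → ∃ K ∈ 𝒦, C ⊆ interior K ∧ K ⊆ U)
    (hU : IsOpen U) (hV : IsOpen V) (ha : DenseRange a) :
    (∃ φ : U ≃ₜ V, ∀ i, φ (a i) = b i) ↔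
      DenseRange b ∧ UniformOnFamily 𝒦 a b ∧ UniformOnFamily 𝒦 b a := by
  have hnhds : ∀ W : Set X, IsOpen W → ∀ x ∈ W, ∃ K ∈ 𝒦, K ∈ 𝓝 x ∧ K ⊆ W := by
    intro W hW x hx
    obtain ⟨K, hK, hxK, hKW⟩ := hsep {x} W isCompact_singleton hW (by simpa using hx)
    exact ⟨K, hK, mem_interior_iff_mem_nhds.1 (hxK rfl), hKW⟩
  have hcov : ∀ W : Set X, IsOpen W → ∀ C ⊆ W, IsCompact C → ∃ L ∈ 𝒦, C ⊆ L ∧ L ⊆ W := by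
    intro W hW C hCW hC
    obtain ⟨K, hK, hCK, hKW⟩ := hsep C W hC hW hCW
    exact ⟨K, hK, hCK.trans interior_subset, hKW⟩
  constructor
  · rintro ⟨φ, hφ⟩
    refine ⟨?_, .of_continuous h𝒦 (hcov V hV) φ.continuous hφ,
      .of_continuous h𝒦 (hcov U hU) φ.symm.continuous fun i => by rw [← hφ, φ.symm_apply_apply]⟩
    have : b = φ ∘ a := funext fun i => (hφ i).symm
    rw [this]
    exact φ.surjective.denseRange.comp ha φ.continuous
  · rintro ⟨hb, hab, hba⟩
    obtain ⟨f, hf, hfa⟩ := hab.exists_continuous h𝒦 (hnhds U hU) ha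
    obtain ⟨g, hg, hgb⟩ := hba.exists_continuous h𝒦 (hnhds V hV) hb
    refine ⟨⟨⟨f, g, congrFun (ha.equalizer (hg.comp hf) continuous_id ?_),
      congrFun (hb.equalizer (hf.comp hg) continuous_id ?_)⟩, hf, hg⟩, hfa⟩
    · funext i; simp [hfa, hgb]
    · funext i; simp [hfa, hgb]

end

theorem denseRange_iff_forall_dist_lt {X ι : Type*} [MetricSpace X] {q : ℕ → X}
    (hq : DenseRange q) {V : Set X} (hV : IsOpen V) {b : ι → V} :
    DenseRange b ↔ ∀ j, q j ∈ V → ∀ k : ℕ, ∃ i, dist (b i : X) (q j) < 1 / (k + 1) := by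
  rw [Metric.denseRange_iff]
  constructor
  · intro h j hj k
    obtain ⟨i, hi⟩ := h ⟨q j, hj⟩ (1 / (k + 1)) Nat.one_div_pos_of_nat
    exact ⟨i, by rwa [dist_comm] at hi⟩
  · intro h x ε hε
    obtain ⟨j, hj, hjV⟩ := hq.exists_mem_open (hV.inter Metric.isOpen_ball)
      ⟨x, x.2, Metric.mem_ball_self (half_pos hε)⟩
    obtain ⟨k, hk⟩ := exists_nat_one_div_lt (half_pos hε)
    obtain ⟨i, hi⟩ := h j hj k
    refine ⟨i, ?_⟩
    rw [Metric.mem_ball, dist_comm] at hjV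
    have := dist_triangle_right (x : X) (b i) (q j)
    rw [Subtype.dist_eq]
    linarith

/-- Let `X` be a locally compact Polish space with a fixed compatible
complete metric, `(qᵢ)` an injective enumeration of a countable dense subset of `X`, and
`u = none` an added isolated point.  The set `𝒯` of triples `(U, V, (rᵢ))` in
`O(X) × O(X) × (X ∪ {u})^ℕ` such that (i) `rᵢ ∈ V` if `qᵢ ∈ U` and `rᵢ = u` otherwise, and
(ii) some homeomorphism `φ : U ≃ₜ V` satisfies `φ(qᵢ) = rᵢ` for all `i` with `qᵢ ∈ U`,
is a Borel subset of `O(X) × O(X) × (X ∪ {u})^ℕ`. -/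
theorem measurableSet_pseudogroup_codes
    {X : Type*} [MetricSpace X] [CompleteSpace X] [SecondCountableTopology X]
    [LocallyCompactSpace X] (q : ℕ → X) (hq_inj : Function.Injective q)
    (hq_dense : DenseRange q) :
    MeasurableSet[(opensFellBorel X).prod
        ((opensFellBorel X).prod (borel (ℕ → Option X)))]
      {p : Opens X × Opens X × (ℕ → Option X) |
        (∀ i : ℕ, (q i ∈ p.1 → ∃ y ∈ p.2.1, p.2.2 i = some y) ∧
          (q i ∉ p.1 → p.2.2 i = none)) ∧
        ∃ φ : ((p.1 : Set X)) ≃ₜ ((p.2.1 : Set X)),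
          ∀ (i : ℕ) (h : q i ∈ (p.1 : Set X)),
            p.2.2 i = some ((φ ⟨q i, h⟩ : (p.2.1 : Set X)) : X)} := by
  obtain ⟨𝒦, h𝒦c, h𝒦, hsep⟩ := exists_countable_compact_between X
  have := h𝒦c.to_subtype
  let _ : MeasurableSpace (Opens X) := opensFellBorel X
  let _ : MeasurableSpace (ℕ → Option X) := borel _
  have : BorelSpace (ℕ → Option X) := ⟨rfl⟩
  let D (ε : ℝ) : Set (Option X × Option X) :=
    Prod.map some some '' {z : X × X | dist z.1 z.2 < ε}
  have mem_D : ∀ {ε : ℝ} {y z : X}, (some y, some z) ∈ D ε ↔ dist y z < ε := by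
    intro ε y z
    simp [D]
  have hD : ∀ ε, IsOpen (D ε) := fun ε =>
    (Option.isOpenEmbedding_some.prodMap Option.isOpenEmbedding_some).isOpenMap _
      (isOpen_lt continuous_dist continuous_const)
  have mU : ∀ K : 𝒦, Measurable fun p : Opens X × Opens X × (ℕ → Option X) =>
      (K : Set X) ⊆ p.1 := fun K =>
    measurableSet_setOfPred.1 (measurable_fst (measurableSet_opensFellBorel_subset (h𝒦 K K.2)))
  have mV : ∀ K : 𝒦, Measurable fun p : Opens X × Opens X × (ℕ → Option X) =>
      (K : Set X) ⊆ p.2.1 := fun K =>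
    measurableSet_setOfPred.1 (measurable_fst.comp measurable_snd
      (measurableSet_opensFellBorel_subset (h𝒦 K K.2)))
  have mqU : ∀ i, Measurable fun p : Opens X × Opens X × (ℕ → Option X) => q i ∈ p.1 := by
    intro i
    simpa using measurableSet_setOfPred.1 (measurable_fst (β := Opens X × (ℕ → Option X))
      (measurableSet_opensFellBorel_subset (isCompact_singleton (x := q i))))
  have mqV : ∀ i, Measurable fun p : Opens X × Opens X × (ℕ → Option X) => q i ∈ p.2.1 := by
    intro i
    simpa using measurableSet_setOfPred.1 (measurable_fst.comp (measurable_snd (α := Opens X))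
      (measurableSet_opensFellBorel_subset (isCompact_singleton (x := q i))))
  have mr : ∀ {S : Set (ℕ → Option X)}, MeasurableSet S →
      Measurable fun p : Opens X × Opens X × (ℕ → Option X) => p.2.2 ∈ S := fun hS =>
    measurableSet_setOfPred.1 (measurable_snd.comp measurable_snd hS)
  have mrK : ∀ (K : 𝒦) i, Measurable fun p : Opens X × Opens X × (ℕ → Option X) =>
      p.2.2 i ∈ some '' (K : Set X) := fun K i =>
    mr (S := {r | r i ∈ some '' (K : Set X)}) ((Option.isClosed_image_some
      (h𝒦 K K.2).isClosed).preimage (continuous_apply i)).measurableSet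
  have mrB : ∀ (x : X) (ε : ℝ) i, Measurable fun p : Opens X × Opens X × (ℕ → Option X) =>
      p.2.2 i ∈ some '' Metric.ball x ε := fun x ε i =>
    mr (S := {r | r i ∈ some '' Metric.ball x ε}) ((Option.isOpenEmbedding_some.isOpenMap _
      Metric.isOpen_ball).preimage (continuous_apply i)).measurableSet
  have mrn : ∀ i, Measurable fun p : Opens X × Opens X × (ℕ → Option X) =>
      p.2.2 i = none := fun i =>
    mr (S := {r | r i ∈ ({none} : Set (Option X))}) (Option.isClosed_singleton_none.preimage
      (continuous_apply i)).measurableSet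
  have mrD : ∀ ε i j, Measurable fun p : Opens X × Opens X × (ℕ → Option X) =>
      (p.2.2 i, p.2.2 j) ∈ D ε := fun ε i j =>
    mr (S := {r | (r i, r j) ∈ D ε}) ((hD ε).preimage
      ((continuous_apply i).prodMk (continuous_apply j))).measurableSet
  have key : ∀ p : Opens X × Opens X × (ℕ → Option X),
      ((∀ i : ℕ, (q i ∈ p.1 → ∃ y ∈ p.2.1, p.2.2 i = some y) ∧ (q i ∉ p.1 → p.2.2 i = none)) ∧
        ∃ φ : ((p.1 : Set X)) ≃ₜ ((p.2.1 : Set X)), ∀ (i : ℕ) (h : q i ∈ (p.1 : Set X)),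
          p.2.2 i = some ((φ ⟨q i, h⟩ : (p.2.1 : Set X)) : X)) ↔
      (∀ i : ℕ, (q i ∈ p.1 → ∃ K : 𝒦, (K : Set X) ⊆ p.2.1 ∧ p.2.2 i ∈ some '' (K : Set X)) ∧
        (q i ∉ p.1 → p.2.2 i = none)) ∧
      (∀ j, q j ∈ p.2.1 → ∀ k : ℕ, ∃ i, p.2.2 i ∈ some '' Metric.ball (q j) (1 / (k + 1))) ∧
      (∀ K : 𝒦, (K : Set X) ⊆ p.1 →
        (∃ L : 𝒦, (L : Set X) ⊆ p.2.1 ∧ ∀ i, q i ∈ (K : Set X) → p.2.2 i ∈ some '' (L : Set X)) ∧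
        ∀ n : ℕ, ∃ m : ℕ, ∀ i j, q i ∈ (K : Set X) → q j ∈ (K : Set X) →
          dist (q i) (q j) < 1 / (m + 1) → (p.2.2 i, p.2.2 j) ∈ D (1 / (n + 1))) ∧
      (∀ K : 𝒦, (K : Set X) ⊆ p.2.1 →
        (∃ L : 𝒦, (L : Set X) ⊆ p.1 ∧ ∀ i, p.2.2 i ∈ some '' (K : Set X) → q i ∈ (L : Set X)) ∧
        ∀ n : ℕ, ∃ m : ℕ, ∀ i j, p.2.2 i ∈ some '' (K : Set X) → p.2.2 j ∈ some '' (K : Set X) →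
          (p.2.2 i, p.2.2 j) ∈ D (1 / (m + 1)) → dist (q i) (q j) < 1 / (n + 1)) := by
    rintro ⟨U, V, r⟩
    have hV : ∀ i, (∃ y ∈ V, r i = some y) ↔
        ∃ K : 𝒦, (K : Set X) ⊆ V ∧ r i ∈ some '' (K : Set X) := by
      intro i
      constructor
      · rintro ⟨y, hy, hi⟩
        obtain ⟨K, hK, hyK, hKV⟩ := hsep {y} V isCompact_singleton V.isOpen (by simpa using hy)
        exact ⟨⟨K, hK⟩, hKV, y, interior_subset (hyK rfl), hi.symm⟩
      · rintro ⟨K, hKV, y, hy, hi⟩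
        exact ⟨y, hKV hy, hi.symm⟩
    simp only [← hV]
    refine and_congr_right fun hr => ?_
    let a : {i // q i ∈ U} → (U : Set X) := fun i => ⟨q i, i.2⟩
    have hb : ∀ i : {i // q i ∈ U}, ∃ y : (V : Set X), r i = some (y : X) := fun i =>
      let ⟨y, hy, h⟩ := (hr i).1 i.2
      ⟨⟨y, hy⟩, h⟩
    choose b hb using hb
    have hmem : ∀ {S : Set X} (i : {i // q i ∈ U}), r i ∈ some '' S ↔ (b i : X) ∈ S := by
      intro S i
      simp [hb]
    have hdom : ∀ {S : Set X} {i : ℕ}, r i ∈ some '' S → q i ∈ U := by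
      rintro S i ⟨y, -, hi⟩
      by_contra h
      simp [(hr i).2 h] at hi
    have ha : DenseRange a := (denseRange_iff_forall_dist_lt hq_dense U.isOpen).2
      fun j hj k => ⟨⟨j, hj⟩, by simpa [a] using Nat.one_div_pos_of_nat (α := ℝ) (n := k)⟩
    have hφ : (∃ φ : (U : Set X) ≃ₜ (V : Set X), ∀ (i : ℕ) (h : q i ∈ (U : Set X)),
        r i = some ((φ ⟨q i, h⟩ : (V : Set X)) : X)) ↔
        ∃ φ : (U : Set X) ≃ₜ (V : Set X), ∀ i, φ (a i) = b i := by
      refine exists_congr fun φ => ⟨fun h i => ?_, fun h i hi => ?_⟩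
      · exact Subtype.ext (Option.some_injective X ((h i i.2).symm.trans (hb i)))
      · rw [hb ⟨i, hi⟩, ← h]
    rw [hφ, exists_homeomorph_iff_uniformOnFamily h𝒦 hsep U.isOpen V.isOpen ha,
      denseRange_iff_forall_dist_lt hq_dense V.isOpen]
    refine and_congr ?_ (and_congr ?_ ?_)
    · refine forall_congr' fun j => imp_congr_right fun _ => forall_congr' fun k => ?_
      constructor
      · rintro ⟨i, hi⟩
        exact ⟨i, (hmem i).2 hi⟩
      · rintro ⟨i, hi⟩
        exact ⟨⟨i, hdom hi⟩, (hmem ⟨i, hdom hi⟩).1 hi⟩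
    · constructor
      · intro h K hKU
        obtain ⟨⟨L, hL, hLV, hKL⟩, hunif⟩ := h K K.2 hKU
        refine ⟨⟨⟨L, hL⟩, hLV, fun i hi => (hmem ⟨i, hKU hi⟩).2 (hKL _ hi)⟩, fun n => ?_⟩
        obtain ⟨m, hm⟩ := hunif n
        refine ⟨m, fun i j hi hj hij => ?_⟩
        rw [hb ⟨i, hKU hi⟩, hb ⟨j, hKU hj⟩, mem_D]
        exact hm _ _ hi hj hij
      · intro h K hK hKU
        obtain ⟨⟨L, hLV, hKL⟩, hunif⟩ := h ⟨K, hK⟩ hKU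
        refine ⟨⟨L, L.2, hLV, fun i hi => (hmem i).1 (hKL _ hi)⟩, fun n => ?_⟩
        obtain ⟨m, hm⟩ := hunif n
        refine ⟨m, fun i j hi hj hij => ?_⟩
        have := hm i j hi hj hij
        rwa [hb, hb, mem_D] at this
    · constructor
      · intro h K hKV
        obtain ⟨⟨L, hL, hLU, hKL⟩, hunif⟩ := h K K.2 hKV
        refine ⟨⟨⟨L, hL⟩, hLU, fun i hi => hKL ⟨i, hdom hi⟩ ((hmem _).1 hi)⟩, fun n => ?_⟩
        obtain ⟨m, hm⟩ := hunif n
        refine ⟨m, fun i j hi hj hij => ?_⟩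
        rw [hb ⟨i, hdom hi⟩, hb ⟨j, hdom hj⟩, mem_D] at hij
        exact hm ⟨i, hdom hi⟩ ⟨j, hdom hj⟩ ((hmem _).1 hi) ((hmem _).1 hj) hij
      · intro h K hK hKV
        obtain ⟨⟨L, hLU, hKL⟩, hunif⟩ := h ⟨K, hK⟩ hKV
        refine ⟨⟨L, L.2, hLU, fun i hi => hKL _ ((hmem i).2 hi)⟩, fun n => ?_⟩
        obtain ⟨m, hm⟩ := hunif n
        refine ⟨m, fun i j hi hj hij => hm i j ((hmem i).2 hi) ((hmem j).2 hj) ?_⟩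
        rwa [hb, hb, mem_D]
  simp_rw [key]
  refine measurableSet_setOfPred.2 (.and ?_ (.and ?_ (.and ?_ ?_)))
  · exact .forall fun i => .and (.imp (mqU i) (.exists fun K => .and (mV K) (mrK K i)))
      (.imp (.not (mqU i)) (mrn i))
  · exact .forall fun j => .imp (mqV j) (.forall fun k => .exists fun i => mrB _ _ i)
  · exact .forall fun K => .imp (mU K) (.and
      (.exists fun L => .and (mV L) (.forall fun i => .imp measurable_const (mrK L i)))
      (.forall fun n => .exists fun m => .forall fun i => .forall fun j =>
        .imp measurable_const (.imp measurable_const (.imp measurable_const (mrD _ i j)))))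
  · exact .forall fun K => .imp (mV K) (.and
      (.exists fun L => .and (mU L) (.forall fun i => .imp (mrK K i) measurable_const))
      (.forall fun n => .exists fun m => .forall fun i => .forall fun j =>
        .imp (mrK K i) (.imp (mrK K j) (.imp (mrD _ i j) measurable_const))))
end

section
/- Let n ≥ 1, let G be a closed subgroup of GL(n, ℝ) (with the topology inherited from the n×n real matrices), and let Γ be a countable subgroup of G. Then there is a countable subgroup Γ̄ of G with Γ ≤ Γ̄ such that whenever Δ, Δ' are subsets of Γ̄ that are conjugate by an element of G (i.e., there is X ∈ G with XΔX⁻¹ = Δ' as sets), they are conjugate by an element of Γ̄ (there is Y ∈ Γ̄ with YΔY⁻¹ = Δ'). -/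
/-- The subgroup generated by a countable set is countable. -/
theorem Set.Countable.subgroup_closure {H : Type*} [Group H] {S : Set H} (hS : S.Countable) :
    (Subgroup.closure S : Set H).Countable := by
  have := hS.to_subtype
  rw [FreeGroup.closure_eq_range, MonoidHom.coe_range]
  exact Set.countable_range _

/-- A countable subgroup of `G` can be enlarged to a countable subgroup of `G` closed under a
given operation from finite sets of pairs to `G`. -/
theorem Subgroup.exists_countable_closed_under_finset_map {H : Type*} [Group H]
    {G Γ : Subgroup H} (hΓG : Γ ≤ G) (hΓ : (Γ : Set H).Countable)
    (c : Finset (H × H) → H) (hc : ∀ s, c s ∈ G) :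
    ∃ K : Subgroup H, K ≤ G ∧ Γ ≤ K ∧ (K : Set H).Countable ∧
      ∀ s : Finset (H × H), (s : Set (H × H)) ⊆ (K : Set H) ×ˢ (K : Set H) → c s ∈ K := by
  let next (K : Subgroup H) : Subgroup H :=
    K ⊔ closure (c '' {s | (s : Set (H × H)) ⊆ (K : Set H) ×ˢ (K : Set H)})
  let F (i : ℕ) : Subgroup H := next^[i] Γ
  have hsucc (i : ℕ) : F (i + 1) = next (F i) := Function.iterate_succ_apply' next i Γ
  have hmono : Monotone F := monotone_nat_of_le_succ fun i => by
    rw [hsucc]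
    exact le_sup_left
  have hF : ((⨆ i, F i : Subgroup H) : Set H) = ⋃ i, (F i : Set H) :=
    coe_iSup_of_directed hmono.directed_le
  refine ⟨⨆ i, F i, iSup_le fun i => ?_, le_iSup F 0, ?_, fun s hs => ?_⟩
  · induction i with
    | zero => exact hΓG
    | succ i ih =>
      rw [hsucc]
      refine sup_le ih ((closure_le G).2 ?_)
      rintro _ ⟨s, -, rfl⟩
      exact hc s
  · rw [hF]
    refine Set.countable_iUnion fun i => ?_
    induction i with
    | zero => exact hΓ
    | succ i ih =>
      rw [hsucc]
      have hsets : {s : Finset (H × H) |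
          (s : Set (H × H)) ⊆ (F i : Set H) ×ˢ (F i : Set H)}.Countable := by
        refine ((Set.countable_ofPred_finite_subset (ih.prod ih)).preimage
          Finset.coe_injective).mono ?_
        exact fun s hs => ⟨s.finite_toSet, hs⟩
      have h := (ih.union (hsets.image c)).subgroup_closure
      rwa [closure_union, closure_eq] at h
  · have hdir : Directed (· ⊆ ·) fun i => (F i : Set H) ×ˢ (F i : Set H) :=
      Monotone.directed_le fun i j hij => Set.prod_mono (hmono hij) (hmono hij)
    have hs' : (s : Set (H × H)) ⊆ ⋃ i, (F i : Set H) ×ˢ (F i : Set H) := by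
      rwa [hF, ← Set.iUnion_prod_of_monotone hmono hmono] at hs
    obtain ⟨i, hi⟩ := hdir.exists_mem_subset_of_finset_subset_biUnion hs'
    refine le_iSup F (i + 1) ?_
    rw [hsucc]
    exact le_sup_right (a := F i) (subset_closure (Set.mem_image_of_mem c hi))

/-- In a Noetherian algebra, conjugation of a set of units is determined by its values on a finite
subset. -/
theorem Units.exists_finset_conj_eq (R : Type*) {A : Type*} [CommSemiring R] [Semiring A]
    [Algebra R A] [IsNoetherian R A] (Δ : Set Aˣ) :
    ∃ s : Finset Aˣ, (s : Set Aˣ) ⊆ Δ ∧ ∀ X Y : Aˣ,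
      (∀ a ∈ s, X * a * X⁻¹ = Y * a * Y⁻¹) → ∀ a ∈ Δ, X * a * X⁻¹ = Y * a * Y⁻¹ := by
  classical
  obtain ⟨t, ht, hspan⟩ := Submodule.fg_span_iff_fg_span_finset_subset
    (R := R) (Units.val '' Δ) |>.1 (IsNoetherian.noetherian _)
  obtain ⟨s, hs, rfl⟩ := Finset.subset_set_image_iff.1 ht
  refine ⟨s, hs, fun X Y hXY a ha => Units.ext ?_⟩
  let conj (X : Aˣ) : A →ₗ[R] A := LinearMap.mulLeftRight R ((X : A), ((X⁻¹ : Aˣ) : A))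
  have hconj : Set.EqOn (conj X) (conj Y) (s.image Units.val : Finset A) := by
    intro b hb
    obtain ⟨a, ha, rfl⟩ := Finset.mem_image.1 (Finset.mem_coe.1 hb)
    simpa [conj] using congrArg Units.val (hXY a ha)
  have hmem : (a : A) ∈ Submodule.span R (s.image Units.val : Finset A) :=
    hspan ▸ Submodule.subset_span (Set.mem_image_of_mem _ ha)
  simpa [conj] using LinearMap.eqOn_span hconj hmem

/-- **countable retract lemma for matrix groups.** Let `G` be a closed
subgroup of `GL(n, ℝ) = (Matrix (Fin n) (Fin n) ℝ)ˣ` (with the topology inherited from the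
`n × n` real matrices) and `Γ` a countable subgroup of `G`.  Then there is a countable
subgroup `Γ̄` of `G` containing `Γ` such that any two subsets of `Γ̄` that are conjugate by
an element of `G` are conjugate by an element of `Γ̄`. -/
theorem countable_conjugacy_retract
    {n : ℕ} (hn : 1 ≤ n)
    (G : Subgroup (Matrix (Fin n) (Fin n) ℝ)ˣ)
    (hG : @IsClosed _
      (TopologicalSpace.induced
        (fun g : (Matrix (Fin n) (Fin n) ℝ)ˣ => (g : Matrix (Fin n) (Fin n) ℝ))
        inferInstance)
      (G : Set (Matrix (Fin n) (Fin n) ℝ)ˣ))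
    (Γ : Subgroup (Matrix (Fin n) (Fin n) ℝ)ˣ) (hΓG : Γ ≤ G)
    (hΓc : (Γ : Set (Matrix (Fin n) (Fin n) ℝ)ˣ).Countable) :
    ∃ Γbar : Subgroup (Matrix (Fin n) (Fin n) ℝ)ˣ,
      Γbar ≤ G ∧ Γ ≤ Γbar ∧ (Γbar : Set (Matrix (Fin n) (Fin n) ℝ)ˣ).Countable ∧
      ∀ Δ Δ' : Set (Matrix (Fin n) (Fin n) ℝ)ˣ,
        Δ ⊆ ↑Γbar → Δ' ⊆ ↑Γbar →
        (∃ X ∈ G, (fun a => X * a * X⁻¹) '' Δ = Δ') →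
        ∃ Y ∈ Γbar, (fun a => Y * a * Y⁻¹) '' Δ = Δ' := by
  classical
  let P (s : Finset ((Matrix (Fin n) (Fin n) ℝ)ˣ × (Matrix (Fin n) (Fin n) ℝ)ˣ))
      (X : (Matrix (Fin n) (Fin n) ℝ)ˣ) : Prop := ∀ p ∈ s, X * p.1 * X⁻¹ = p.2
  have hP (s) : ∃ Y ∈ G, (∃ X ∈ G, P s X) → P s Y := by
    by_cases h : ∃ X ∈ G, P s X
    · obtain ⟨X, hX, hs⟩ := h
      exact ⟨X, hX, fun _ => hs⟩
    · exact ⟨1, G.one_mem, fun h' => absurd h' h⟩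
  choose c hcG hcP using hP
  obtain ⟨K, hKG, hΓK, hK, hcK⟩ :=
    Subgroup.exists_countable_closed_under_finset_map hΓG hΓc c hcG
  refine ⟨K, hKG, hΓK, hK, ?_⟩
  rintro Δ _ hΔ hΔ' ⟨X, hX, rfl⟩
  obtain ⟨s, hsΔ, hs⟩ := Units.exists_finset_conj_eq ℝ Δ
  let graph := s.image fun a => (a, X * a * X⁻¹)
  have hgraph : (graph : Set (_ × _)) ⊆
      (K : Set (Matrix (Fin n) (Fin n) ℝ)ˣ) ×ˢ (K : Set (Matrix (Fin n) (Fin n) ℝ)ˣ) := by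
    intro p hp
    obtain ⟨a, ha, rfl⟩ := Finset.mem_image.1 (Finset.mem_coe.1 hp)
    exact ⟨hΔ (hsΔ ha), hΔ' (Set.mem_image_of_mem _ (hsΔ ha))⟩
  have hXgraph : P graph X := by
    intro p hp
    obtain ⟨a, -, rfl⟩ := Finset.mem_image.1 hp
    rfl
  refine ⟨c graph, hcK graph hgraph, Set.image_congr (hs _ _ fun a ha => ?_)⟩
  exact hcP graph ⟨X, hX, hXgraph⟩ _ (Finset.mem_image_of_mem _ ha)
end

section
/- Let n ≥ 1, let G be a subgroup of GL(n, ℝ), let N be a countable normal subgroup of G, and let Γ be a countable subgroup of the quotient group G/N. Then there is a countable subgroup Γ̄ of G/N with Γ ≤ Γ̄ such that whenever Δ, Δ' are subsets of Γ̄ that are conjugate by an element of G/N (i.e., there is x ∈ G/N with xΔx⁻¹ = Δ' as sets), they are conjugate by an element of Γ̄ (there is y ∈ Γ̄ with yΔy⁻¹ = Δ'). -/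
theorem Subgroup.countable_closure {H : Type*} [Group H] {s : Set H} (hs : s.Countable) :
    Countable (Subgroup.closure s) := by
  have := hs.to_subtype
  have : Countable (FreeGroup s) := Quot.mk_surjective.countable
  rw [FreeGroup.closure_eq_range]
  exact (FreeGroup.lift ((↑) : s → H)).rangeRestrict_surjective.countable

/-- Every countable subgroup lies in a countable subgroup closed under a given function
of finite subsets. -/
theorem Subgroup.exists_countable_closed_under {H : Type*} [Group H] (c : Finset (H × H) → H)
    (Γ : Subgroup H) [Countable Γ] :
    ∃ K : Subgroup H, Γ ≤ K ∧ Countable K ∧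
      ∀ F : Finset (H × H), (∀ p ∈ F, p.1 ∈ K ∧ p.2 ∈ K) → c F ∈ K := by
  let adjoin (L : Subgroup H) : Subgroup H :=
    Subgroup.closure (L ∪ c '' {F | (F : Set (H × H)) ⊆ (L : Set H) ×ˢ (L : Set H)})
  have le_adjoin (L : Subgroup H) : L ≤ adjoin L := fun x hx =>
    Subgroup.subset_closure (Or.inl hx)
  have countable_adjoin (L : Subgroup H) (hL : Countable L) : Countable (adjoin L) := by
    have hL' : (L : Set H).Countable := hL
    refine Subgroup.countable_closure (hL'.union (Set.Countable.image ?_ c))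
    refine ((Set.countable_ofPred_finite_subset (hL'.prod hL')).preimage
      Finset.coe_injective).mono fun F hF => ?_
    exact ⟨F.finite_toSet, hF⟩
  let chain (k : ℕ) : Subgroup H := adjoin^[k] Γ
  have chain_succ (k : ℕ) : chain (k + 1) = adjoin (chain k) :=
    Function.iterate_succ_apply' adjoin k Γ
  have chain_mono : Monotone chain :=
    monotone_nat_of_le_succ fun k => (le_adjoin _).trans_eq (chain_succ k).symm
  have countable_chain (k : ℕ) : Countable (chain k) := by
    induction k with
    | zero => assumption
    | succ k ih => rw [chain_succ]; exact countable_adjoin _ ih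
  have coe_iSup : ((⨆ k, chain k : Subgroup H) : Set H) = ⋃ k, (chain k : Set H) :=
    Subgroup.coe_iSup_of_directed chain_mono.directed_le
  refine ⟨⨆ k, chain k, le_iSup chain 0, ?_, fun F hF => ?_⟩
  · change ((⨆ k, chain k : Subgroup H) : Set H).Countable
    rw [coe_iSup]
    exact Set.countable_iUnion countable_chain
  · have hsub : (F : Set (H × H)) ⊆ ⋃ k, (chain k : Set H) ×ˢ (chain k : Set H) := by
      intro p hp
      obtain ⟨h₁, h₂⟩ := hF p hp
      obtain ⟨i, hi⟩ := (Subgroup.mem_iSup_of_directed chain_mono.directed_le).1 h₁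
      obtain ⟨j, hj⟩ := (Subgroup.mem_iSup_of_directed chain_mono.directed_le).1 h₂
      exact Set.mem_iUnion.2
        ⟨max i j, chain_mono (le_max_left i j) hi, chain_mono (le_max_right i j) hj⟩
    have hmono : Monotone fun k => (chain k : Set H) ×ˢ (chain k : Set H) :=
      fun i j hij => Set.prod_mono (chain_mono hij) (chain_mono hij)
    obtain ⟨k, hk⟩ := hmono.directed_le.exists_mem_subset_of_finset_subset_biUnion hsub
    have hmem : c F ∈ chain (k + 1) := by
      rw [chain_succ]
      exact Subgroup.subset_closure (Or.inr ⟨F, hk, rfl⟩)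
    exact le_iSup chain (k + 1) hmem

/-- A system of conjugation equations over a Noetherian algebra is equivalent to a finite
subsystem. -/
theorem Units.exists_finset_conj_eq_s11 {R A : Type*} [CommRing R] [Ring A] [Algebra R A]
    [IsNoetherian R A] {G : Subgroup Aˣ} (S : Set (G × G)) :
    ∃ F : Finset (G × G), ↑F ⊆ S ∧ ∀ y : G,
      (∀ p ∈ F, y * p.1 * y⁻¹ = p.2) → ∀ p ∈ S, y * p.1 * y⁻¹ = p.2 := by
  classical
  let ι (p : G × G) : A × A := (((p.1 : Aˣ) : A), ((p.2 : Aˣ) : A))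
  obtain ⟨T, hTS, hT⟩ := Submodule.fg_span_iff_fg_span_finset_subset (R := R) (ι '' S) |>.1
    (IsNoetherian.noetherian _)
  obtain ⟨F, hFS, rfl⟩ := Finset.subset_set_image_iff.1 hTS
  refine ⟨F, hFS, fun y hy p hp => ?_⟩
  let W : Submodule R (A × A) := LinearMap.ker
    (LinearMap.mulLeft R ((y : Aˣ) : A) ∘ₗ LinearMap.fst R A A -
      LinearMap.mulRight R ((y : Aˣ) : A) ∘ₗ LinearMap.snd R A A)
  have mem_W (q : G × G) : ι q ∈ W ↔ y * q.1 * y⁻¹ = q.2 := by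
    rw [_root_.mul_inv_eq_iff_eq_mul, Subtype.ext_iff, Units.ext_iff]
    simp [W, ι, sub_eq_zero]
  have hle : Submodule.span R (ι '' S) ≤ W := by
    rw [hT, Submodule.span_le]
    intro q hq
    obtain ⟨r, hr, rfl⟩ := Finset.mem_image.1 hq
    exact (mem_W r).2 (hy r hr)
  exact (mem_W p).1 (hle (Submodule.subset_span ⟨p, hp, rfl⟩))

theorem Units.exists_countable_conj_retract {R A : Type*} [CommRing R] [Ring A] [Algebra R A]
    [IsNoetherian R A] {G : Subgroup Aˣ} (Γ : Subgroup G) [Countable Γ] :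
    ∃ K : Subgroup G, Γ ≤ K ∧ Countable K ∧
      ∀ (Δ : Set G) (x : G), Δ ⊆ K → (∀ a ∈ Δ, x * a * x⁻¹ ∈ K) →
        ∃ y ∈ K, ∀ a ∈ Δ, y * a * y⁻¹ = x * a * x⁻¹ := by
  classical
  let c (F : Finset (G × G)) : G :=
    if h : ∃ y : G, ∀ p ∈ F, y * p.1 * y⁻¹ = p.2 then h.choose else 1
  obtain ⟨K, hΓK, hK, hc⟩ := Subgroup.exists_countable_closed_under c Γ
  refine ⟨K, hΓK, hK, fun Δ x hΔ hx => ?_⟩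
  obtain ⟨F, hF, hFS⟩ :=
    Units.exists_finset_conj_eq_s11 (R := R) ((fun a => (a, x * a * x⁻¹)) '' Δ)
  have hex : ∃ y : G, ∀ p ∈ F, y * p.1 * y⁻¹ = p.2 := by
    refine ⟨x, fun p hp => ?_⟩
    obtain ⟨a, -, rfl⟩ := hF hp
    rfl
  refine ⟨c F, hc F fun p hp => ?_, fun a ha => ?_⟩
  · obtain ⟨a, ha, rfl⟩ := hF hp
    exact ⟨hΔ ha, hx a ha⟩
  · have hcF : ∀ p ∈ F, c F * p.1 * (c F)⁻¹ = p.2 := by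
      simp only [c, dif_pos hex]
      exact hex.choose_spec
    exact hFS (c F) hcF _ ⟨a, ha, rfl⟩

theorem QuotientGroup.countable_comap_mk {H : Type*} [Group H] (N : Subgroup H) [N.Normal]
    [Countable N] (Γ : Subgroup (H ⧸ N)) [Countable Γ] :
    Countable (Γ.comap (QuotientGroup.mk' N)) :=
  have : Countable (Γ : Set (H ⧸ N)) := ‹Countable Γ›
  (QuotientGroup.preimageMkEquivSubgroupProdSet N (Γ : Set (H ⧸ N))).countable_iff.2 inferInstance


/-- **countable retract lemma for quotients of matrix groups.** Let `G` be
a subgroup of `GL(n, ℝ) = (Matrix (Fin n) (Fin n) ℝ)ˣ`, `N` a countable normal subgroup of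
`G`, and `Γ` a countable subgroup of the quotient group `G/N`.  Then there is a countable
subgroup `Γ̄` of `G/N` containing `Γ` such that any two subsets of `Γ̄` that are conjugate
by an element of `G/N` are conjugate by an element of `Γ̄`. -/
theorem countable_conjugacy_retract_quotient
    {n : ℕ} (hn : 1 ≤ n)
    (G : Subgroup (Matrix (Fin n) (Fin n) ℝ)ˣ)
    (N : Subgroup ↥G) [N.Normal] (hNc : Countable N)
    (Γ : Subgroup (↥G ⧸ N)) (hΓc : Countable Γ) :
    ∃ Γbar : Subgroup (↥G ⧸ N),
      Γ ≤ Γbar ∧ Countable Γbar ∧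
      ∀ Δ Δ' : Set (↥G ⧸ N),
        Δ ⊆ ↑Γbar → Δ' ⊆ ↑Γbar →
        (∃ x : ↥G ⧸ N, (fun a => x * a * x⁻¹) '' Δ = Δ') →
        ∃ y ∈ Γbar, (fun a => y * a * y⁻¹) '' Δ = Δ' := by
  have := QuotientGroup.countable_comap_mk N Γ
  obtain ⟨K, hΓK, hK, hconj⟩ :=
    Units.exists_countable_conj_retract (R := ℝ) (Γ.comap (QuotientGroup.mk' N))
  have hNK : (QuotientGroup.mk' N).ker ≤ K :=
    (MonoidHom.ker_le_comap _ _).trans hΓK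
  have hcomap : (K.map (QuotientGroup.mk' N)).comap (QuotientGroup.mk' N) = K :=
    Subgroup.comap_map_eq_self hNK
  have mem_K (g : G) (hg : (g : G ⧸ N) ∈ K.map (QuotientGroup.mk' N)) : g ∈ K := by
    rw [← hcomap]
    exact hg
  refine ⟨K.map (QuotientGroup.mk' N), ?_, Set.Countable.image (s := (K : Set G)) hK _, ?_⟩
  · rw [← Subgroup.map_comap_eq_self_of_surjective (QuotientGroup.mk'_surjective N) Γ]
    exact Subgroup.map_mono hΓK
  rintro Δ _ hΔ hΔ' ⟨x, rfl⟩
  obtain ⟨x, rfl⟩ := QuotientGroup.mk_surjective x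
  obtain ⟨y, hyK, hy⟩ := hconj (QuotientGroup.mk ⁻¹' Δ) x (fun a ha => mem_K a (hΔ ha))
    fun a ha => mem_K _ (hΔ' ⟨a, ha, rfl⟩)
  refine ⟨y, ⟨y, hyK, rfl⟩, Set.image_congr fun a ha => ?_⟩
  obtain ⟨a, rfl⟩ := QuotientGroup.mk_surjective a
  exact congrArg (QuotientGroup.mk (s := N)) (hy a ha)
end

section
/- Let X and Y be standard Borel spaces and let E and F be essentially countable Borel equivalence relations on X and Y, respectively. Suppose f : X → Y is a weak Borel reduction from E to F. If F is concretely classifiable, i.e., Borel reducible to the equality relation on ℝ, then E is also Borel reducible to the equality relation on ℝ. -/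
universe u v

/-- A countable Borel equivalence relation on a standard Borel space: a standard Borel
space together with an equivalence relation that is Borel as a subset of the square and
all of whose classes are countable. -/
structure CountableBorelER : Type (u + 1) where
  carrier : Type u
  inst : MeasurableSpace carrier
  standardBorel : @StandardBorelSpace carrier inst
  rel : carrier → carrier → Prop
  isEquivalence : Equivalence rel
  measurableSet_rel : @MeasurableSet (carrier × carrier) (inst.prod inst) {p | rel p.1 p.2}
  countable_classes : ∀ z, {w | rel z w}.Countable

attribute [instance] CountableBorelER.inst

/-- `E` is Borel reducible to `F`: there is a Borel measurable `f` with
`E x x' ↔ F (f x) (f x')`. -/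
def BorelReducible {X Y : Type*} [MeasurableSpace X] [MeasurableSpace Y]
    (E : X → X → Prop) (F : Y → Y → Prop) : Prop :=
  ∃ f : X → Y, Measurable f ∧ ∀ a b : X, E a b ↔ F (f a) (f b)

/-- `E` is essentially countable: it is Borel bireducible with a countable Borel
equivalence relation on a standard Borel space. -/
def EssentiallyCountable {X : Type*} [MeasurableSpace X] (E : X → X → Prop) : Prop :=
  ∃ C : CountableBorelER.{u}, BorelReducible E C.rel ∧ BorelReducible C.rel E

/-- `f` is a weak Borel reduction from `E` to `F`: a Borel homomorphism such that the
preimage of each `F`-class meets only countably many `E`-classes. -/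
def WeakBorelReduction {X Y : Type*} [MeasurableSpace X] [MeasurableSpace Y]
    (E : X → X → Prop) (F : Y → Y → Prop) (f : X → Y) : Prop :=
  Measurable f ∧ (∀ a b : X, E a b → F (f a) (f b)) ∧
    ∀ y : Y, ∃ S : Set X, S.Countable ∧ ∀ x : X, F (f x) y → ∃ x' ∈ S, E x x'

open Set Filter Topology MeasureTheory

/-- A set is small for `p` if it is a countable union of Borel sets on which `p` is injective. -/
def IsSmallFor {Z Y : Type*} [MeasurableSpace Z] (p : Z → Y) (S : Set Z) : Prop :=
  ∃ C : ℕ → Set Z, (∀ n, MeasurableSet (C n)) ∧ (∀ n, InjOn p (C n)) ∧ S = ⋃ n, C n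

/-- A family of sets is large for `p` if it admits, off any small set, a selector contained in a
single fibre of `p`. -/
def IsLargeFor {Z Y ι : Type*} [MeasurableSpace Z] (p : Z → Y) (U : ι → Set Z) : Prop :=
  ∀ S, IsSmallFor p S → ∃ z : ι → Z, (∀ i, z i ∈ U i \ S) ∧ ∀ i j, p (z i) = p (z j)

namespace IsSmallFor

variable {Z Y : Type*} [MeasurableSpace Z] {p : Z → Y}

theorem measurableSet {S : Set Z} (hS : IsSmallFor p S) : MeasurableSet S := by
  obtain ⟨C, hC, -, rfl⟩ := hS
  exact .iUnion hC

theorem of_injOn {S : Set Z} (hS : MeasurableSet S) (h : InjOn p S) : IsSmallFor p S :=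
  ⟨fun _ => S, fun _ => hS, fun _ => h, (iUnion_const S).symm⟩

theorem iUnion {κ : Type*} [Countable κ] {S : κ → Set Z} (hS : ∀ k, IsSmallFor p (S k)) :
    IsSmallFor p (⋃ k, S k) := by
  choose C hC hinj hSC using hS
  rcases isEmpty_or_nonempty κ with hκ | hκ
  · exact ⟨fun _ => ∅, by simp, by simp, by simp⟩
  obtain ⟨e, he⟩ := exists_surjective_nat (κ × ℕ)
  refine ⟨fun n => C (e n).1 (e n).2, fun n => hC _ _, fun n => hinj _ _, ?_⟩
  rw [he.iUnion_comp (fun q : κ × ℕ => C q.1 q.2), iUnion_prod']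
  exact iUnion_congr hSC

theorem union {S T : Set Z} (hS : IsSmallFor p S) (hT : IsSmallFor p T) :
    IsSmallFor p (S ∪ T) := by
  rw [union_eq_iUnion]
  exact iUnion (by rintro (_ | _) <;> assumption)

end IsSmallFor

section Reflection

variable {Z Y : Type*} [TopologicalSpace Z] [PolishSpace Z] [MeasurableSpace Z] [BorelSpace Z]
  [TopologicalSpace Y] [T2Space Y] [SecondCountableTopology Y] [MeasurableSpace Y] [BorelSpace Y]
  {p : Z → Y}

theorem MeasureTheory.AnalyticSet.inter {X : Type*} [TopologicalSpace X] [T2Space X]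
    {s t : Set X} (hs : AnalyticSet s) (ht : AnalyticSet t) : AnalyticSet (s ∩ t) := by
  rw [inter_eq_iInter]
  exact AnalyticSet.iInter (by rintro (_ | _) <;> assumption)

/-- The points sharing their fibre with a different point of an analytic set form an analytic
set. -/
theorem MeasureTheory.AnalyticSet.exists_ne_map_eq (hp : Measurable p) {A : Set Z}
    (hA : AnalyticSet A) : AnalyticSet {z | ∃ w ∈ A, p w = p z ∧ w ≠ z} := by
  have hm : MeasurableSet {q : Z × Z | p q.1 = p q.2 ∧ q.1 ≠ q.2} :=
    (measurableSet_eq_fun (hp.comp measurable_fst) (hp.comp measurable_snd)).inter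
      (measurableSet_eq_fun measurable_fst measurable_snd).compl
  convert ((hA.preimage (continuous_fst (X := Z) (Y := Z))).inter
    hm.analyticSet).image_of_continuous continuous_snd using 1
  ext z
  simp

/-- An analytic set on which `p` is injective is contained in a Borel set on which `p` is
injective. -/
theorem MeasureTheory.AnalyticSet.exists_measurableSet_injOn (hp : Measurable p) {A : Set Z}
    (hA : AnalyticSet A) (hinj : InjOn p A) : ∃ B, A ⊆ B ∧ MeasurableSet B ∧ InjOn p B := by
  obtain ⟨B₀, hAB₀, hd₀, hB₀⟩ := hA.measurablySeparable (hA.exists_ne_map_eq hp) (by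
    rw [Set.disjoint_left]
    rintro z hz ⟨w, hw, hwz, hne⟩
    exact hne (hinj hw hz hwz))
  obtain ⟨B₁, hAB₁, hd₁, hB₁⟩ :=
    hA.measurablySeparable (hB₀.analyticSet.exists_ne_map_eq hp) (by
      rw [Set.disjoint_left]
      rintro z hz ⟨w, hw, hwz, hne⟩
      exact Set.disjoint_left.1 hd₀ ⟨z, hz, hwz.symm, hne.symm⟩ hw)
  refine ⟨B₀ ∩ B₁, subset_inter hAB₀ hAB₁, hB₀.inter hB₁, fun z hz w hw h => ?_⟩
  by_contra hne
  exact Set.disjoint_left.1 hd₁ ⟨z, hz.1, h, hne⟩ hw.2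

/-- Off any small set, a large family of Borel sets admits two disjoint selectors contained in
the same fibre. -/
theorem IsLargeFor.exists_pair {ι : Type*} [Finite ι] (hp : Measurable p) {U : ι → Set Z}
    (hUm : ∀ i, MeasurableSet (U i)) (hU : IsLargeFor p U) {S : Set Z} (hS : IsSmallFor p S) :
    ∃ z : ι × Bool → Z, (∀ k, z k ∈ U k.1 \ S) ∧ (∀ k l, p (z k) = p (z l)) ∧
      ∀ i, z (i, false) ≠ z (i, true) := by
  classical
  cases nonempty_fintype ι
  suffices H : ∀ T : Finset ι, ∀ S, IsSmallFor p S → ∃ z : ι × Bool → Z,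
      (∀ k, z k ∈ U k.1 \ S) ∧ (∀ k l, p (z k) = p (z l)) ∧
      ∀ i ∈ T, z (i, false) ≠ z (i, true) by
    obtain ⟨z, h₁, h₂, h₃⟩ := H Finset.univ S hS
    exact ⟨z, h₁, h₂, fun i => h₃ i (Finset.mem_univ i)⟩
  intro T
  induction T using Finset.induction_on with
  | empty =>
    intro S hS
    obtain ⟨z, hz, hpz⟩ := hU S hS
    exact ⟨fun k => z k.1, fun k => hz k.1, fun k l => hpz _ _, by simp⟩
  | insert j T hj ih =>
    intro S hS
    let G : Set (ι × Bool → Z) := {z | (∀ k, z k ∈ U k.1 \ S) ∧ (∀ k l, p (z k) = p (z l)) ∧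
      ∀ i ∈ T, z (i, false) ≠ z (i, true)}
    have hG : MeasurableSet G := by
      have h₁ : MeasurableSet {z : ι × Bool → Z | ∀ k, z k ∈ U k.1 \ S} := by
        rw [ofPred_forall]
        exact .iInter fun k => measurable_pi_apply k ((hUm _).diff hS.measurableSet)
      have h₂ : MeasurableSet {z : ι × Bool → Z | ∀ k l, p (z k) = p (z l)} := by
        simp only [ofPred_forall]
        exact .iInter fun k => .iInter fun l => measurableSet_eq_fun
          (hp.comp (measurable_pi_apply k)) (hp.comp (measurable_pi_apply l))
      have h₃ : MeasurableSet {z : ι × Bool → Z | ∀ i ∈ T, z (i, false) ≠ z (i, true)} := by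
        simp only [ofPred_forall]
        exact .iInter fun i => .iInter fun _ => (measurableSet_eq_fun
          (measurable_pi_apply (i, false)) (measurable_pi_apply (i, true))).compl
      exact h₁.inter (h₂.inter h₃)
    have hA : AnalyticSet ((fun z : ι × Bool → Z => z (j, false)) '' G) :=
      hG.analyticSet.image_of_continuous (continuous_apply _)
    by_cases hinj : InjOn p ((fun z : ι × Bool → Z => z (j, false)) '' G)
    · obtain ⟨B, hAB, hB, hBinj⟩ := hA.exists_measurableSet_injOn hp hinj
      obtain ⟨z, h₁, h₂, h₃⟩ := ih (S ∪ B) (hS.union (.of_injOn hB hBinj))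
      exact absurd (hAB ⟨z, ⟨fun k => ⟨(h₁ k).1, fun h => (h₁ k).2 (.inl h)⟩, h₂, h₃⟩, rfl⟩)
        fun h => (h₁ (j, false)).2 (.inr h)
    · simp only [InjOn, not_forall] at hinj
      obtain ⟨_, ⟨z, hz, rfl⟩, _, ⟨w, hw, rfl⟩, hpzw, hne⟩ := hinj
      have hval : ∀ k, Function.update z (j, true) (w (j, false)) k = z k ∨
          (k = (j, true) ∧ Function.update z (j, true) (w (j, false)) k = w (j, false)) := by
        intro k
        by_cases hk : k = (j, true)
        · subst hk; simp
        · simp [hk]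
      have hfib : ∀ k, p (Function.update z (j, true) (w (j, false)) k) = p (z (j, false)) := by
        intro k
        rcases hval k with h | ⟨-, h⟩
        · rw [h, hz.2.1]
        · rw [h, hpzw]
      refine ⟨Function.update z (j, true) (w (j, false)), fun k => ?_,
        fun k l => (hfib k).trans (hfib l).symm, fun i hi => ?_⟩
      · rcases hval k with h | ⟨rfl, h⟩
        · rw [h]; exact hz.1 k
        · rw [h]; exact hw.1 (j, false)
      · by_cases hij : i = j
        · subst hij; simpa using hne
        · have := hz.2.2 i (Finset.mem_of_mem_insert_of_ne hi hij)
          simpa [hij] using this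

end Reflection

section Scheme

theorem exists_mem_countableBasis_closure_subset {Z : Type*} [MetricSpace Z]
    [SecondCountableTopology Z] {z : Z} {W : Set Z} (hW : IsOpen W) (hz : z ∈ W)
    {ε : ENNReal} (hε : 0 < ε) :
    ∃ V ∈ TopologicalSpace.countableBasis Z, z ∈ V ∧ closure V ⊆ W ∧ Metric.ediam V ≤ ε := by
  obtain ⟨O, hO, hOcl, hOW⟩ := exists_mem_nhds_isClosed_subset (hW.mem_nhds hz)
  have hball : Metric.eball z (ε / 2) ∈ 𝓝 z := Metric.eball_mem_nhds z (ENNReal.half_pos hε.ne')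
  obtain ⟨V, hV, hzV, hVO⟩ := (TopologicalSpace.isBasis_countableBasis Z).mem_nhds_iff.1
    (inter_mem hO hball)
  refine ⟨V, hV, hzV, (closure_minimal (hVO.trans inter_subset_left) hOcl).trans hOW, ?_⟩
  calc Metric.ediam V ≤ Metric.ediam (Metric.eball z (ε / 2)) :=
        Metric.ediam_mono (hVO.trans inter_subset_right)
    _ ≤ 2 * (ε / 2) := Metric.ediam_eball_le
    _ = ε := ENNReal.mul_div_cancel (by simp) (by simp)

variable {Z Y : Type*} [MetricSpace Z] [SecondCountableTopology Z] [CompleteSpace Z]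
  [MeasurableSpace Z] [BorelSpace Z]
  [TopologicalSpace Y] [T2Space Y] [SecondCountableTopology Y] [MeasurableSpace Y] [BorelSpace Y]
  {p : Z → Y}

/-- A large family of open sets can be split into a large family of twice as many small, pairwise
separated open sets. -/
theorem IsLargeFor.exists_split {ι : Type*} [Finite ι] (hp : Measurable p) {U : ι → Set Z}
    (hUo : ∀ i, IsOpen (U i)) (hU : IsLargeFor p U) {ε : ENNReal} (hε : 0 < ε) :
    ∃ V : ι × Bool → Set Z, (∀ k, IsOpen (V k)) ∧ IsLargeFor p V ∧
      (∀ k, closure (V k) ⊆ U k.1) ∧ (∀ k, Metric.ediam (V k) ≤ ε) ∧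
      ∀ i, Disjoint (V (i, false)) (V (i, true)) := by
  let b := TopologicalSpace.countableBasis Z
  have : Countable b := (TopologicalSpace.countable_countableBasis Z).to_subtype
  let K := {V : ι × Bool → b // (∀ k, closure (V k : Set Z) ⊆ U k.1) ∧
    (∀ k, Metric.ediam (V k : Set Z) ≤ ε) ∧
    ∀ i, Disjoint (V (i, false) : Set Z) (V (i, true))}
  by_contra! H
  have hK : ∀ V : K, ∃ S, IsSmallFor p S ∧ ∀ z : ι × Bool → Z,
      (∀ k, z k ∈ (V.1 k : Set Z) \ S) → ¬ ∀ k l, p (z k) = p (z l) := by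
    intro V
    have hV : ¬ IsLargeFor p (fun k => (V.1 k : Set Z)) := fun hV => by
      obtain ⟨i, hi⟩ := H _ (fun k => TopologicalSpace.isOpen_of_mem_countableBasis (V.1 k).2) hV
        V.2.1 V.2.2.1
      exact hi (V.2.2.2 i)
    simpa only [IsLargeFor, not_forall, not_exists, not_and, exists_prop] using hV
  choose S hS hSV using hK
  obtain ⟨z, hzU, hpz, hne⟩ :=
    hU.exists_pair hp (fun i => (hUo i).measurableSet) (IsSmallFor.iUnion hS)
  have hW : ∀ i, ∃ W : Bool → Set Z, (∀ c, IsOpen (W c) ∧ z (i, c) ∈ W c) ∧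
      Disjoint (W false) (W true) := by
    intro i
    obtain ⟨O, O', hO, hO', hz, hz', hd⟩ := t2_separation (hne i)
    exact ⟨fun c => cond c O' O, by rintro (_ | _) <;> simp_all, hd⟩
  choose W hW hWd using hW
  have hV : ∀ k : ι × Bool, ∃ V ∈ b, z k ∈ V ∧ closure V ⊆ U k.1 ∩ W k.1 k.2 ∧
      Metric.ediam V ≤ ε := fun k =>
    exists_mem_countableBasis_closure_subset ((hUo _).inter (hW _ _).1)
      ⟨(hzU k).1, (hW _ _).2⟩ hε
  choose V hVb hzV hVcl hVε using hV
  let V' : K := ⟨fun k => ⟨V k, hVb k⟩, fun k => (hVcl k).trans inter_subset_left, hVε, fun i =>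
    (hWd i).mono (subset_closure.trans ((hVcl (i, false)).trans inter_subset_right))
      (subset_closure.trans ((hVcl (i, true)).trans inter_subset_right))⟩
  exact hSV V' z (fun k => ⟨hzV k, fun h => (hzU k).2 (mem_iUnion_of_mem V' h)⟩) hpz

/-- If the whole space is not small for a continuous `p`, then some fibre of `p` is
uncountable. -/
theorem exists_not_countable_fiber (hp : Continuous p) (hlarge : ¬ IsSmallFor p (univ : Set Z)) :
    ∃ y, ¬ {z | p z = y}.Countable := by
  let L (n : ℕ) := {U : (Fin n → Bool) → Set Z // (∀ s, IsOpen (U s)) ∧ IsLargeFor p U}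
  have hstep : ∀ n (U : L n), ∃ V : L (n + 1),
      (∀ s, closure (V.1 s) ⊆ U.1 (Fin.tail s)) ∧
      (∀ s, Metric.ediam (V.1 s) ≤ (n + 1 : ENNReal)⁻¹) ∧
      ∀ s : Fin n → Bool, Disjoint (V.1 (Fin.cons false s)) (V.1 (Fin.cons true s)) := by
    intro n U
    obtain ⟨V, hVo, hVl, hVcl, hVε, hVd⟩ := U.2.2.exists_split hp.measurable U.2.1
      (ε := (n + 1 : ENNReal)⁻¹) (by simp)
    refine ⟨⟨fun s => V (Fin.tail s, s 0), fun s => hVo _, fun S hS => ?_⟩,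
      fun s => hVcl _, fun s => hVε _, fun s => by simpa using hVd s⟩
    obtain ⟨z, hz, hpz⟩ := hVl S hS
    exact ⟨fun s => z (Fin.tail s, s 0), fun s => hz _, fun s t => hpz _ _⟩
  choose next hcl hdiam hdisj using hstep
  let U₀ : L 0 := ⟨fun _ => univ, fun _ => isOpen_univ, fun S hS => by
    have : ∃ x, x ∉ S := by
      by_contra! h
      exact hlarge (eq_univ_of_forall h ▸ hS)
    obtain ⟨x, hx⟩ := this
    exact ⟨fun _ => x, fun _ => ⟨mem_univ _, hx⟩, fun _ _ => rfl⟩⟩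
  let U : ∀ n, L n := fun n => Nat.rec U₀ next n
  let A : List Bool → Set Z := fun l => (U l.length).1 l.get
  have hA_cl : CantorScheme.ClosureAntitone A := fun l a => hcl l.length (U l.length) (a :: l).get
  have hcons : ∀ (a : Bool) (l : List Bool),
      (a :: l).get = Fin.cons (α := fun _ => Bool) a l.get := by
    intro a l
    ext i
    refine Fin.cases ?_ (fun j => ?_) i <;> simp
  have hA_disj : CantorScheme.Disjoint A := by
    have key : ∀ l, Disjoint (A (false :: l)) (A (true :: l)) := fun l => by
      have := hdisj l.length (U l.length) l.get
      rw [← hcons, ← hcons] at this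
      exact this
    rintro l (_ | _) (_ | _) hab
    · exact absurd rfl hab
    · exact key l
    · exact (key l).symm
    · exact absurd rfl hab
  have hA_diam : CantorScheme.VanishingDiam A := by
    intro x
    rw [← tendsto_add_atTop_iff_nat 1]
    refine tendsto_of_tendsto_of_tendsto_of_le_of_le tendsto_const_nhds
      ((tendsto_add_atTop_iff_nat 1).2 ENNReal.tendsto_inv_nat_nhds_zero) (fun _ => zero_le)
      fun n => ?_
    have := hdiam _ (U (PiNat.res x n).length) (x n :: PiNat.res x n).get
    have hle : Metric.ediam (A (PiNat.res x (n + 1))) ≤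
        ((PiNat.res x n).length + 1 : ENNReal)⁻¹ := this
    simpa only [PiNat.res_length, Nat.cast_add, Nat.cast_one] using hle
  have hmem : ∀ n, ∃ z : (ℕ → Bool) → Z, (∀ x, z x ∈ A (PiNat.res x n)) ∧
      ∀ x y, p (z x) = p (z y) := by
    intro n
    obtain ⟨z, hz, hpz⟩ := (U n).2.2 ∅ (.of_injOn .empty (injOn_empty p))
    have hz' : ∀ l : List Bool, l.length = n → ∃ w ∈ A l, ∃ s, w = z s := by
      rintro l rfl
      exact ⟨z l.get, (hz _).1, _, rfl⟩
    choose w hw hwz using fun x : ℕ → Bool => hz' (PiNat.res x n) (PiNat.res_length x n)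
    refine ⟨w, hw, fun x y => ?_⟩
    obtain ⟨s, hs⟩ := hwz x
    obtain ⟨t, ht⟩ := hwz y
    rw [hs, ht, hpz]
  have hA_ne : ∀ l, (A l).Nonempty := fun l => by
    obtain ⟨z, hz, -⟩ := (U l.length).2.2 ∅ (.of_injOn .empty (injOn_empty p))
    exact ⟨_, (hz l.get).1⟩
  have hdom := hA_cl.map_of_vanishingDiam hA_diam hA_ne
  let g : (ℕ → Bool) → Z := fun x => (CantorScheme.inducedMap A).2 ⟨x, hdom ▸ mem_univ x⟩
  have hg_mem : ∀ x n, g x ∈ A (PiNat.res x n) := fun x n => CantorScheme.map_mem _ n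
  have hg_inj : Function.Injective g := fun x y h =>
    congrArg Subtype.val (hA_disj.map_injective h)
  choose z hz hpz using hmem
  have hlim : ∀ x, Tendsto (fun n => p (z n x)) atTop (𝓝 (p (g x))) := by
    intro x
    refine (hp.tendsto _).comp ?_
    rw [tendsto_iff_edist_tendsto_0]
    exact tendsto_of_tendsto_of_tendsto_of_le_of_le tendsto_const_nhds (hA_diam x)
      (fun _ => zero_le) fun n => Metric.edist_le_ediam_of_mem (hz n x) (hg_mem x n)
  have hfib : ∀ x, p (g x) = p (g fun _ => false) := fun x =>
    tendsto_nhds_unique (hlim x) ((hlim fun _ => false).congr fun n => hpz n _ _)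
  refine ⟨p (g fun _ => false), fun hc => ?_⟩
  have : Countable {z | p z = p (g fun _ => false)} := hc.to_subtype
  have : Countable (ℕ → Bool) := Function.Injective.countable
    (f := fun x => (⟨g x, hfib x⟩ : {z | p z = p (g fun _ => false)}))
    fun x y h => hg_inj (congrArg Subtype.val h)
  obtain ⟨e, he⟩ := exists_surjective_nat (ℕ → Bool)
  obtain ⟨n, hn⟩ := he fun n => !(e n n)
  simpa using congrFun hn n

end Scheme

/-- **Lusin–Novikov**: a standard Borel space on which a Borel map `p` is countable-to-one is a
countable union of Borel sets on which `p` is injective. -/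
theorem isSmallFor_univ_of_countable_fibers {Z Y : Type*} [MeasurableSpace Z]
    [StandardBorelSpace Z] [TopologicalSpace Y] [T2Space Y] [SecondCountableTopology Y]
    [MeasurableSpace Y] [BorelSpace Y] {p : Z → Y} (hp : Measurable p)
    (hc : ∀ y, {z | p z = y}.Countable) : IsSmallFor p (univ : Set Z) := by
  obtain ⟨t, ht, htp⟩ := StandardBorelSpace.polish (α := Z)
  obtain ⟨t', ht't, hpc, ht'⟩ := hp.exists_continuous
  have hb : @BorelSpace Z t' _ :=
    ⟨ht.measurable_eq.trans ((borel_eq_borel_of_le ht' htp ht't).symm)⟩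
  clear ht htp ht't
  let := TopologicalSpace.upgradeIsCompletelyMetrizable Z
  by_contra h
  obtain ⟨y, hy⟩ := exists_not_countable_fiber hpc h
  exact hy (hc y)

/-- A Borel equivalence relation admitting an invariant countable-to-one Borel map to `ℝ` is
Borel reducible to equality on `ℝ`. -/
theorem borelReducible_eq_of_countable_fibers {Z : Type*} [MeasurableSpace Z]
    [StandardBorelSpace Z] {R : Z → Z → Prop} (hR : Equivalence R)
    (hRm : MeasurableSet {q : Z × Z | R q.1 q.2}) {p : Z → ℝ} (hp : Measurable p)
    (hRp : ∀ a b, R a b → p a = p b) (hc : ∀ y, {z | p z = y}.Countable) :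
    BorelReducible R (fun a b : ℝ => a = b) := by
  classical
  obtain ⟨C, hC, hinj, hcov⟩ := isSmallFor_univ_of_countable_fibers hp hc
  let D (n : ℕ) : Set Z := {z | ∃ w ∈ C n, R w z}
  have hD : ∀ n, MeasurableSet (D n) := by
    intro n
    have h : MeasurableSet (Prod.snd '' ((Prod.fst ⁻¹' C n) ∩ {q : Z × Z | R q.1 q.2})) := by
      refine ((measurable_fst (hC n)).inter hRm).image_of_measurable_injOn measurable_snd ?_
      rintro ⟨w, z⟩ ⟨hw, hwz⟩ ⟨w', z'⟩ ⟨hw', hwz'⟩ (rfl : z = z')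
      exact Prod.ext (hinj n hw hw' ((hRp _ _ hwz).trans (hRp _ _ hwz').symm)) rfl
    convert h using 1
    ext z
    simp [D]
  let c : Z → ℝ × (ℕ → Bool) := fun z => (p z, fun n => decide (z ∈ D n))
  have hcm : Measurable c := hp.prodMk (measurable_pi_lambda _ fun n =>
    measurable_to_bool (by simpa [preimage] using hD n))
  have hemb := measurableEmbedding_embeddingReal (ℝ × (ℕ → Bool))
  refine ⟨fun z => embeddingReal _ (c z), hemb.measurable.comp hcm, fun a b => ?_⟩
  refine Iff.trans ?_ hemb.injective.eq_iff.symm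
  constructor
  · intro hab
    refine Prod.ext (hRp _ _ hab) (funext fun n => decide_eq_decide.2 ?_)
    exact ⟨fun ⟨w, hw, hwa⟩ => ⟨w, hw, hR.trans hwa hab⟩,
      fun ⟨w, hw, hwb⟩ => ⟨w, hw, hR.trans hwb (hR.symm hab)⟩⟩
  · intro h
    obtain ⟨n, hn⟩ := mem_iUnion.1 (hcov ▸ mem_univ a)
    have hD : a ∈ D n ↔ b ∈ D n := decide_eq_decide.1 (congrFun (congrArg Prod.snd h) n)
    obtain ⟨w, hw, hwb⟩ := hD.1 ⟨a, hn, hR.refl a⟩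
    obtain rfl := hinj n hw hn ((hRp _ _ hwb).trans (congrArg Prod.fst h).symm)
    exact hwb

/-- Let `E` and `F` be essentially countable Borel equivalence relations
on standard Borel spaces `X` and `Y`, and let `f : X → Y` be a weak Borel reduction from
`E` to `F`.  If `F` is concretely classifiable (Borel reducible to equality on `ℝ`), then
so is `E`. -/
theorem concretely_classifiable_of_weak_reduction
    {X Y : Type*} [MeasurableSpace X] [StandardBorelSpace X]
    [MeasurableSpace Y] [StandardBorelSpace Y]
    (E : X → X → Prop) (F : Y → Y → Prop)
    (hEeq : Equivalence E) (hFeq : Equivalence F)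
    (hEmeas : MeasurableSet {p : X × X | E p.1 p.2})
    (hFmeas : MeasurableSet {p : Y × Y | F p.1 p.2})
    (hEec : EssentiallyCountable.{u} E) (hFec : EssentiallyCountable.{v} F)
    (f : X → Y) (hf : WeakBorelReduction E F f)
    (hF : BorelReducible F (fun a b : ℝ => a = b)) :
    BorelReducible E (fun a b : ℝ => a = b) := by
  obtain ⟨C, ⟨g, hg, hgE⟩, h, hh, hhC⟩ := hEec
  obtain ⟨φ, hφ, hφF⟩ := hF
  obtain ⟨hfm, hfE, hfc⟩ := hf
  have := C.standardBorel
  obtain ⟨k, hk, hkC⟩ := borelReducible_eq_of_countable_fibers C.isEquivalence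
    C.measurableSet_rel (p := fun z => φ (f (h z))) (hφ.comp (hfm.comp hh))
    (fun a b hab => (hφF _ _).1 (hfE _ _ ((hhC a b).1 hab))) (by
      intro y
      rcases eq_empty_or_nonempty {z | φ (f (h z)) = y} with h0 | ⟨z₀, rfl⟩
      · exact h0 ▸ countable_empty
      obtain ⟨S, hS, hSE⟩ := hfc (f (h z₀))
      refine (hS.biUnion (t := fun x _ => {z | E (h z) x}) fun x _ => ?_).mono fun z hz => ?_
      · rcases eq_empty_or_nonempty {z | E (h z) x} with h0 | ⟨w, hw⟩
        · exact h0 ▸ countable_empty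
        · exact (C.countable_classes w).mono fun z hz =>
            (hhC w z).2 (hEeq.trans hw (hEeq.symm hz))
      · obtain ⟨x, hx, hzx⟩ := hSE (h z) ((hφF _ _).2 hz)
        exact mem_biUnion hx hzx)
  exact ⟨fun x => k (g x), hk.comp hg, fun a b => (hgE a b).trans (hkC _ _)⟩
end
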